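/- arXiv:1802.07830 — 14 statements merged into one kernel-verified Lean document; each statement's English description precedes it below -/
import Mathlib

section
/- Let n, m ∈ ℕ and let W be an n × m matrix with integer entries. Then the set {x ∈ ℤⁿ | ∀ i, (x ᵥ* W) i ≥ 0} of integer row vectors x whose product with W is componentwise nonnegative is a finitely generated additive submonoid of ℤⁿ (under coordinatewise addition). -/
/-- Coordinatewise inclusion of natural vectors into integer vectors. -/
def natVecToInt (k : ℕ) : (Fin k → ℕ) →+ (Fin k → ℤ) :=
  (Nat.castAddMonoidHom ℤ).compLeft (Fin k)

/-- Hilbert's theorem (Theorem II of Hilbert 1890): the set of integer row vectors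
whose product with an integer matrix `W` is componentwise nonnegative is a
finitely generated additive submonoid of `ℤⁿ`. -/
theorem hilbert_finitely_generated (n m : ℕ) (W : Matrix (Fin n) (Fin m) ℤ) :
    ∃ S : Finset (Fin n → ℤ),
      (AddSubmonoid.closure (S : Set (Fin n → ℤ)) : Set (Fin n → ℤ)) =
        {x : Fin n → ℤ | ∀ i, 0 ≤ Matrix.vecMul x W i} := by
  let M := (Fin n → ℕ) × (Fin n → ℕ) × (Fin m → ℕ)
  let d : M →+ (Fin n → ℤ) :=
    (natVecToInt n).comp (AddMonoidHom.fst _ _) -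
      (natVecToInt n).comp ((AddMonoidHom.fst _ _).comp (AddMonoidHom.snd _ _))
  let f : M →+ (Fin m → ℤ) := W.vecMulLinear.toAddMonoidHom.comp d
  let g : M →+ (Fin m → ℤ) :=
    (natVecToInt m).comp ((AddMonoidHom.snd _ _).comp (AddMonoidHom.snd _ _))
  obtain ⟨S, hS⟩ := (AddSubmonoid.fg_eqLocusM f g).map d
  refine ⟨S, ?_⟩
  rw [hS]
  ext x
  constructor
  · rintro ⟨p, hp, rfl⟩ i
    have h : Matrix.vecMul (d p) W i = (p.2.2 i : ℤ) := congrFun hp i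
    rw [h]
    positivity
  · intro hx
    let p : M :=
      (fun i => (x i).toNat, fun i => (-x i).toNat, fun i => (Matrix.vecMul x W i).toNat)
    have hd : d p = x := funext fun i => Int.toNat_sub_toNat_neg (x i)
    refine ⟨p, ?_, hd⟩
    change Matrix.vecMul (d p) W = _
    rw [hd]
    exact funext fun i => (Int.toNat_of_nonneg (hx i)).symm
end

section
/- Let Z be a finitely generated additive abelian group, let m ∈ ℕ, and let φ : Z →+ (Fin m → ℤ) be an additive group homomorphism. Then the preimage φ⁻¹({y | ∀ i, 0 ≤ y i}) of the nonnegative orthant is finitely generated as an additive monoid, i.e., as an additive submonoid of Z it is the additive-monoid closure of a finite set. -/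
/-- The preimage of a finitely generated submonoid of a cancellative commutative monoid under a
homomorphism from a finitely generated commutative monoid is finitely generated. -/
theorem AddSubmonoid.FG.comap_of_isCancelAdd {M N : Type*} [AddCommMonoid M] [AddMonoid.FG M]
    [AddCommMonoid N] [IsCancelAdd N] {P : AddSubmonoid N} (hP : P.FG) (f : M →+ N) :
    (P.comap f).FG := by
  obtain ⟨n, g, hg⟩ := AddSubmonoid.fg_iff_exists_fin_addMonoidHom.1 (AddMonoid.FG.fg_top (M := M))
  rw [AddMonoidHom.mrange_eq_top] at hg
  obtain ⟨k, h, rfl⟩ := AddSubmonoid.fg_iff_exists_fin_addMonoidHom.1 hP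
  let p : (Fin n → ℕ) × (Fin k → ℕ) →+ M := g.comp (AddMonoidHom.fst _ _)
  have hfg := (AddSubmonoid.fg_eqLocusM (f.comp p) (h.comp (AddMonoidHom.snd _ _))).map p
  convert hfg using 1
  ext x
  constructor
  · rintro ⟨b, hb⟩
    obtain ⟨a, rfl⟩ := hg x
    exact ⟨(a, b), hb.symm, rfl⟩
  · rintro ⟨⟨a, b⟩, hab, rfl⟩
    exact ⟨b, hab.symm⟩

/-- The nonnegative orthant of `ℤᵐ` is a finitely generated additive monoid. -/
theorem AddSubmonoid.fg_nonneg_int_pi (m : ℕ) : (AddSubmonoid.nonneg (Fin m → ℤ)).FG := by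
  refine AddSubmonoid.fg_iff_exists_fin_addMonoidHom.2
    ⟨m, (Nat.castAddMonoidHom ℤ).compLeft (Fin m), ?_⟩
  ext y
  constructor
  · rintro ⟨a, rfl⟩ i
    exact Int.natCast_nonneg (a i)
  · intro hy
    exact ⟨fun i => (y i).toNat, funext fun i => Int.toNat_of_nonneg (hy i)⟩

/-- The preimage of the nonnegative orthant of `ℤᵐ` under an additive group
homomorphism from a finitely generated abelian group is finitely generated as
an additive monoid. -/
theorem preimage_orthant_fg_addMonoid (Z : Type*) [AddCommGroup Z] [AddGroup.FG Z]
    (m : ℕ) (φ : Z →+ (Fin m → ℤ)) :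
    ∃ S : Finset Z,
      (AddSubmonoid.closure (S : Set Z) : Set Z) =
        φ ⁻¹' {y : Fin m → ℤ | ∀ i, 0 ≤ y i} := by
  have : AddMonoid.FG Z := AddGroup.fg_iff_addMonoid_fg.1 ‹_›
  obtain ⟨S, hS⟩ := (AddSubmonoid.fg_nonneg_int_pi m).comap_of_isCancelAdd φ
  exact ⟨S, congrArg SetLike.coe hS⟩
end

section
/- Let Z be a finite-dimensional vector space over ℚ, let m ∈ ℕ, and let φ : Z →ₗ[ℚ] (Fin m → ℚ) be a ℚ-linear map. Then there exists a finite set S ⊆ Z such that φ⁻¹({y | ∀ i, 0 ≤ y i}) is exactly the set of all finite linear combinations ∑_{s ∈ S} q s • s with coefficients q s ∈ ℚ, q s ≥ 0. In other words, the preimage of the nonnegative orthant is finitely generated as a ℚ₊-semimodule. -/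
namespace PointedCone

section Field

variable {K E : Type*} [Field K] [LinearOrder K] [IsStrictOrderedRing K] [AddCommGroup E]
  [Module K E]

lemma hull_union_neg_eq_top {s : Set E} (hs : Submodule.span K s = ⊤) :
    hull K (s ∪ -s) = ⊤ := by
  have key : ∀ x ∈ Submodule.span K s, x ∈ hull K (s ∪ -s) ∧ -x ∈ hull K (s ∪ -s) := by
    intro x hx
    induction hx using Submodule.span_induction with
    | mem x hx =>
      exact ⟨subset_hull (Or.inl hx), subset_hull (Or.inr (by simpa using hx))⟩
    | zero => simp
    | add x y _ _ hx hy =>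
      exact ⟨add_mem hx.1 hy.1, by rw [neg_add]; exact add_mem hx.2 hy.2⟩
    | smul a x _ hx =>
      rcases le_total 0 a with ha | ha
      · exact ⟨smul_mem _ ha hx.1, by rw [← smul_neg]; exact smul_mem _ ha hx.2⟩
      · have ha' : 0 ≤ -a := neg_nonneg.2 ha
        exact ⟨by rw [← neg_smul_neg]; exact smul_mem _ ha' hx.2,
          by rw [← neg_smul]; exact smul_mem _ ha' hx.1⟩
  exact eq_top_iff.2 fun x _ ↦ (key x (hs ▸ Submodule.mem_top)).1

lemma fg_top [FiniteDimensional K E] : (⊤ : PointedCone K E).FG := by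
  obtain ⟨s, hs⟩ := (Module.Finite.fg_top : (⊤ : Submodule K E).FG)
  exact Submodule.fg_def.2
    ⟨_, s.finite_toSet.union s.finite_toSet.neg, hull_union_neg_eq_top hs⟩

lemma eq_zero_or_neg_of_mem_hull {f : E →ₗ[K] K} {t : Set E} (ht : ∀ y ∈ t, f y < 0) {b : E}
    (hb : b ∈ hull K t) : b = 0 ∨ f b < 0 := by
  induction hb using Submodule.span_induction with
  | mem y hy => exact Or.inr (ht y hy)
  | zero => exact Or.inl rfl
  | add x y _ _ hx hy =>
    rcases hx with rfl | hx
    · simpa using hy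
    · rcases hy with rfl | hy
      · simpa using Or.inr hx
      · exact Or.inr (by rw [map_add]; exact add_neg hx hy)
  | smul a x _ hx =>
    obtain ⟨a, ha⟩ := a
    change a • x = 0 ∨ f (a • x) < 0
    rcases hx with rfl | hx
    · simp
    · rcases ha.eq_or_lt with rfl | ha
      · simp
      · exact Or.inr (by rw [map_smul, smul_eq_mul]; exact mul_neg_of_pos_of_neg ha hx)

lemma smul_sub_smul_mem_of_mem_hull {f : E →ₗ[K] K} {s t : Set E} {C : PointedCone K E}
    (h : ∀ x ∈ s, ∀ y ∈ t, f x • y - f y • x ∈ C) {a b : E} (ha : a ∈ hull K s)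
    (hb : b ∈ hull K t) : f a • b - f b • a ∈ C := by
  induction ha, hb using Submodule.span_induction₂ with
  | mem_mem x y hx hy => exact h x hx y hy
  | zero_left y hy => simp
  | zero_right x hx => simp
  | add_left x y z _ _ _ hx hy =>
    convert! add_mem hx hy using 1
    rw [map_add]; module
  | add_right x y z _ _ _ hx hy =>
    convert! add_mem hx hy using 1
    rw [map_add]; module
  | smul_left r x y _ _ hxy =>
    obtain ⟨r, hr⟩ := r
    change f (r • x) • y - f y • (r • x) ∈ C
    convert! smul_mem C hr hxy using 1
    rw [map_smul, smul_eq_mul]; module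
  | smul_right r x y _ _ hxy =>
    obtain ⟨r, hr⟩ := r
    change f x • (r • y) - f (r • y) • x ∈ C
    convert! smul_mem C hr hxy using 1
    rw [map_smul, smul_eq_mul]; module

/-- One step of the double description method: generators of the intersection of a cone with
a half-space. -/
lemma hull_inf_comap_positive (f : E →ₗ[K] K) (s : Set E) :
    hull K s ⊓ (positive K K).comap f =
      hull K ({x ∈ s | 0 ≤ f x} ∪
        Set.image2 (fun x y ↦ f x • y - f y • x) {x ∈ s | 0 ≤ f x} {y ∈ s | f y < 0}) := by
  set p := {x ∈ s | 0 ≤ f x}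
  set n := {y ∈ s | f y < 0}
  apply le_antisymm
  · rintro x ⟨hx, hfx⟩
    have hfx : 0 ≤ f x := hfx
    have hs : s = p ∪ n := by
      ext y
      simp only [p, n, Set.mem_union, Set.mem_ofPred_eq, ← and_or_left, le_or_gt, and_true]
    rw [hs, SetLike.mem_coe, hull, Submodule.span_union] at hx
    obtain ⟨a, ha, b, hb, rfl⟩ := Submodule.mem_sup.1 hx
    have hab := smul_sub_smul_mem_of_mem_hull
      (C := hull K (p ∪ Set.image2 (fun x y ↦ f x • y - f y • x) p n))
      (fun x hx y hy ↦ subset_hull (Or.inr (Set.mem_image2_of_mem hx hy))) ha hb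
    have ha' := Submodule.span_mono (R := {c : K // 0 ≤ c})
      (Set.subset_union_left (t := Set.image2 (fun x y ↦ f x • y - f y • x) p n)) ha
    rcases eq_zero_or_neg_of_mem_hull (fun y hy ↦ hy.2) hb with rfl | hfb
    · simpa using ha'
    · rw [map_add] at hfx
      have hfa : 0 < f a := by linarith
      rw [← smul_mem_iff _ hfa]
      convert! add_mem hab (smul_mem _ hfx ha') using 1
      module
  · refine Submodule.span_le.2 (Set.union_subset ?_ ?_)
    · exact fun x hx ↦ ⟨subset_hull hx.1, hx.2⟩
    · rintro _ ⟨x, hx, y, hy, rfl⟩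
      refine ⟨?_, ?_⟩
      · change f x • y - f y • x ∈ hull K s
        rw [sub_eq_add_neg, ← neg_smul]
        exact add_mem (smul_mem _ hx.2 (subset_hull hy.1))
          (smul_mem _ (neg_nonneg.2 hy.2.le) (subset_hull hx.1))
      · change 0 ≤ f (f x • y - f y • x)
        simp [mul_comm]

lemma FG.inf_comap_positive {C : PointedCone K E} (hC : C.FG) (f : E →ₗ[K] K) :
    (C ⊓ (positive K K).comap f).FG := by
  obtain ⟨s, hs, rfl⟩ := Submodule.fg_def.1 hC
  have hp : {x ∈ s | 0 ≤ f x}.Finite := hs.sep _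
  exact Submodule.fg_def.2
    ⟨_, hp.union (hp.image2 _ (hs.sep _)), (hull_inf_comap_positive f s).symm⟩

lemma fg_iInf_comap_positive [FiniteDimensional K E] {ι : Type*} (f : ι → E →ₗ[K] K)
    (t : Finset ι) : (⨅ i ∈ t, (positive K K).comap (f i)).FG := by
  classical
  induction t using Finset.induction_on with
  | empty => simpa using fg_top
  | insert i t _ ih =>
    rw [Finset.iInf_insert, inf_comm]
    exact FG.inf_comap_positive ih (f i)

lemma mem_hull_finset {s : Finset E} {x : E} :
    x ∈ hull K (s : Set E) ↔ ∃ q : E → K, (∀ y, 0 ≤ q y) ∧ x = ∑ y ∈ s, q y • y := by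
  constructor
  · intro hx
    obtain ⟨c, hc, hc₀, rfl⟩ := mem_hull_set.1 hx
    exact ⟨c, hc₀, Finsupp.sum_of_support_subset c (by exact_mod_cast hc) _ (by simp)⟩
  · rintro ⟨q, hq, rfl⟩
    exact sum_mem fun y hy ↦ smul_mem _ (hq y) (subset_hull hy)

end Field

end PointedCone

/-- The preimage of the nonnegative orthant of `ℚᵐ` under a `ℚ`-linear map from
a finite-dimensional `ℚ`-vector space is finitely generated as a
`ℚ₊`-semimodule: it is the set of nonnegative rational linear combinations of a
finite set. -/
theorem preimage_orthant_fg_nonnegRat (Z : Type*) [AddCommGroup Z] [Module ℚ Z]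
    [FiniteDimensional ℚ Z] (m : ℕ) (φ : Z →ₗ[ℚ] (Fin m → ℚ)) :
    ∃ S : Finset Z,
      φ ⁻¹' {y : Fin m → ℚ | ∀ i, 0 ≤ y i} =
        {z : Z | ∃ q : Z → ℚ, (∀ s, 0 ≤ q s) ∧ z = ∑ s ∈ S, q s • s} := by
  obtain ⟨S, hS⟩ := PointedCone.fg_iInf_comap_positive
    (fun i ↦ LinearMap.proj i ∘ₗ φ) (Finset.univ : Finset (Fin m))
  refine ⟨S, Set.ext fun z ↦ ?_⟩
  rw [Set.mem_ofPred_eq, ← PointedCone.mem_hull_finset, PointedCone.hull, hS]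
  simp [Submodule.mem_iInf]
end

section
/- Let n₁, n₂ ∈ ℕ and let Z be a linear subspace of ℝ^{n₁} × ℝ^{n₂} (i.e., of (Fin n₁ → ℝ) × (Fin n₂ → ℝ)). Then there exists a finite set S ⊆ Z ∩ (Δ^{n₁} × Δ^{n₂}) such that Z ∩ (Δ^{n₁} × Δ^{n₂}) equals the set of all subconvex combinations ∑_{s ∈ S} p s • s with p s ≥ 0 and ∑_{s ∈ S} p s ≤ 1. In other words, Z ∩ (Δ^{n₁} × Δ^{n₂}) is finitely generated as a positively convex algebra. -/
open Set Filter Topology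

/-- Two extreme points of a polyhedron at which the same constraints are active coincide. -/
theorem extremePoints_polyhedron_injOn {E J : Type*} [AddCommGroup E] [Module ℝ E] [Finite J]
    (Z : Submodule ℝ E) (f : J → E →ₗ[ℝ] ℝ) (b : J → ℝ) :
    InjOn (fun x => {j | f j x = b j})
      (extremePoints ℝ ((Z : Set E) ∩ {z | ∀ j, f j z ≤ b j})) := by
  intro x hx y hy hxy
  obtain ⟨⟨hxZ, hxb⟩, hext⟩ := hx
  obtain ⟨⟨hyZ, hyb⟩, -⟩ := hy
  have active (j : J) : f j x = b j ↔ f j y = b j := Set.ext_iff.mp hxy j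
  have feasible : ∀ᶠ ε : ℝ in 𝓝[>] 0, ∀ j, f j (x - ε • (y - x)) ≤ b j := by
    rw [eventually_all]
    intro j
    simp only [map_sub, map_smul, smul_eq_mul]
    rcases (hxb j).eq_or_lt with h | h
    · have hy' := (active j).mp h
      simp [h, hy']
    · have lim : Tendsto (fun ε : ℝ => f j x - ε * (f j y - f j x)) (𝓝[>] 0) (𝓝 (f j x)) := by
        have : Continuous (fun ε : ℝ => f j x - ε * (f j y - f j x)) := by fun_prop
        simpa using (this.tendsto 0).mono_left nhdsWithin_le_nhds
      exact (lim.eventually_lt_const h).mono fun _ => le_of_lt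
  obtain ⟨ε, hε, hpos⟩ := (feasible.and self_mem_nhdsWithin).exists
  have hpos : 0 < ε := hpos
  refine (hext ⟨hyZ, hyb⟩ ⟨Z.sub_mem hxZ (Z.smul_mem ε (Z.sub_mem hyZ hxZ)), hε⟩
    ⟨ε / (1 + ε), 1 / (1 + ε), by positivity, by positivity, by field_simp; ring, ?_⟩).symm
  match_scalars <;> field_simp <;> ring

theorem finite_extremePoints_polyhedron {E J : Type*} [AddCommGroup E] [Module ℝ E] [Finite J]
    (Z : Submodule ℝ E) (f : J → E →ₗ[ℝ] ℝ) (b : J → ℝ) :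
    (extremePoints ℝ ((Z : Set E) ∩ {z | ∀ j, f j z ≤ b j})).Finite :=
  Set.Finite.of_finite_image (Set.toFinite _) (extremePoints_polyhedron_injOn Z f b)

/-- A convex compact set with finitely many extreme points is the convex hull of them. -/
theorem IsCompact.convexHull_extremePoints_of_finite {E : Type*} [NormedAddCommGroup E]
    [NormedSpace ℝ E] {P : Set E} (hP : IsCompact P) (hconv : Convex ℝ P)
    (hfin : (extremePoints ℝ P).Finite) : convexHull ℝ (extremePoints ℝ P) = P := by
  rw [← hfin.isClosed_convexHull ℝ |>.closure_eq, closure_convexHull_extremePoints hP hconv]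

theorem Convex.sum_smul_mem_of_sum_le_one {E ι : Type*} [AddCommGroup E] [Module ℝ E]
    {P : Set E} (hP : Convex ℝ P) (h0 : (0 : E) ∈ P) {s : Finset ι} {p : ι → ℝ} {z : ι → E}
    (hp : ∀ i ∈ s, 0 ≤ p i) (hsum : ∑ i ∈ s, p i ≤ 1) (hz : ∀ i ∈ s, z i ∈ P) :
    ∑ i ∈ s, p i • z i ∈ P := by
  rcases (Finset.sum_nonneg hp).eq_or_lt with h | h
  · rw [eq_comm, Finset.sum_eq_zero_iff_of_nonneg hp] at h
    rwa [Finset.sum_eq_zero fun i hi => by rw [h i hi, zero_smul]]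
  · have := hP.smul_mem_of_zero_mem h0 (hP.centerMass_mem hp h hz) ⟨h.le, hsum⟩
    rwa [Finset.centerMass, smul_inv_smul₀ h.ne'] at this

/-- A compact polyhedron containing the origin is the set of subconvex combinations of a finite
subset of itself. -/
theorem exists_finset_eq_subconvex_combinations {E J : Type*} [NormedAddCommGroup E]
    [NormedSpace ℝ E] [Finite J] (Z : Submodule ℝ E) (f : J → E →ₗ[ℝ] ℝ) (b : J → ℝ)
    {P : Set E} (hP : P = (Z : Set E) ∩ {z | ∀ j, f j z ≤ b j})
    (hcomp : IsCompact P) (h0 : (0 : E) ∈ P) :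
    ∃ S : Finset E, (S : Set E) ⊆ P ∧
      P = {z | ∃ p : E → ℝ, (∀ s, 0 ≤ p s) ∧ (∑ s ∈ S, p s) ≤ 1 ∧ z = ∑ s ∈ S, p s • s} := by
  classical
  have hconv : Convex ℝ P := by
    rw [hP, ofPred_forall]
    exact Z.convex.inter (convex_iInter fun j => convex_halfSpace_le (f j).isLinear (b j))
  have hfin : (extremePoints ℝ P).Finite := hP ▸ finite_extremePoints_polyhedron Z f b
  have hsub : (hfin.toFinset : Set E) ⊆ P := by
    simpa using extremePoints_subset
  refine ⟨hfin.toFinset, hsub, Subset.antisymm ?_ ?_⟩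
  · intro z hz
    rw [← hcomp.convexHull_extremePoints_of_finite hconv hfin, ← hfin.coe_toFinset,
      Finset.mem_convexHull'] at hz
    obtain ⟨w, hw, hw1, rfl⟩ := hz
    refine ⟨fun s => if s ∈ hfin.toFinset then w s else 0, fun s => ?_, ?_, ?_⟩
    · dsimp only
      split_ifs with h
      exacts [hw s h, le_rfl]
    · rw [Finset.sum_congr rfl fun s hs => if_pos hs, hw1]
    · exact Finset.sum_congr rfl fun s hs => by simp only [if_pos hs]
  · rintro z ⟨p, hp, hp1, rfl⟩
    exact hconv.sum_smul_mem_of_sum_le_one h0 (fun s _ => hp s) hp1 fun s hs => hsub hs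

theorem isClosed_subprobabilitySimplex (n : ℕ) :
    IsClosed {x : Fin n → ℝ | (∀ i, 0 ≤ x i) ∧ ∑ i, x i ≤ 1} := by
  rw [ofPred_and, ofPred_forall]
  exact (isClosed_iInter fun i => isClosed_le (by fun_prop) (by fun_prop)).inter
    (isClosed_le (by fun_prop) (by fun_prop))

theorem isCompact_subprobabilitySimplex (n : ℕ) :
    IsCompact {x : Fin n → ℝ | (∀ i, 0 ≤ x i) ∧ ∑ i, x i ≤ 1} :=
  (isCompact_Icc (a := (0 : Fin n → ℝ)) (b := 1)).of_isClosed_subset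
    (isClosed_subprobabilitySimplex n) fun _ hx =>
      ⟨hx.1, fun i =>
        (Finset.single_le_sum (fun j _ => hx.1 j) (Finset.mem_univ i)).trans hx.2⟩

/-- The linear forms `-x i` (at `some i`) and `∑ i, x i` (at `none`) defining `Δⁿ`. -/
def subprobabilityForm (n : ℕ) : Option (Fin n) → (Fin n → ℝ) →ₗ[ℝ] ℝ
  | none => ∑ i, LinearMap.proj i
  | some i => -LinearMap.proj i

/-- The bounds matching `subprobabilityForm`. -/
def subprobabilityBound (n : ℕ) : Option (Fin n) → ℝ
  | none => 1
  | some _ => 0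

theorem forall_subprobabilityForm_le_iff (n : ℕ) (x : Fin n → ℝ) :
    (∀ j, subprobabilityForm n j x ≤ subprobabilityBound n j) ↔
      (∀ i, 0 ≤ x i) ∧ ∑ i, x i ≤ 1 := by
  simp [Option.forall, subprobabilityForm, subprobabilityBound, and_comm]

/-- The intersection of a linear subspace of `ℝ^{n₁} × ℝ^{n₂}` with the product
of the subprobability simplices `Δ^{n₁} × Δ^{n₂}` is finitely generated as a
positively convex algebra: it is the set of subconvex combinations of a finite
subset of itself. -/
theorem subspace_inter_simplices_fg_pca (n₁ n₂ : ℕ)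
    (Z : Submodule ℝ ((Fin n₁ → ℝ) × (Fin n₂ → ℝ))) :
    ∃ S : Finset ((Fin n₁ → ℝ) × (Fin n₂ → ℝ)),
      (S : Set ((Fin n₁ → ℝ) × (Fin n₂ → ℝ))) ⊆
        (Z : Set ((Fin n₁ → ℝ) × (Fin n₂ → ℝ))) ∩
          ({x | (∀ i, 0 ≤ x i) ∧ ∑ i, x i ≤ 1} ×ˢ
            {x | (∀ i, 0 ≤ x i) ∧ ∑ i, x i ≤ 1}) ∧
      (Z : Set ((Fin n₁ → ℝ) × (Fin n₂ → ℝ))) ∩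
          ({x | (∀ i, 0 ≤ x i) ∧ ∑ i, x i ≤ 1} ×ˢ
            {x | (∀ i, 0 ≤ x i) ∧ ∑ i, x i ≤ 1}) =
        {z | ∃ p : ((Fin n₁ → ℝ) × (Fin n₂ → ℝ)) → ℝ,
          (∀ s, 0 ≤ p s) ∧ (∑ s ∈ S, p s) ≤ 1 ∧ z = ∑ s ∈ S, p s • s} := by
  refine exists_finset_eq_subconvex_combinations Z
    (Sum.elim (fun j => subprobabilityForm n₁ j ∘ₗ LinearMap.fst ℝ _ _)
      (fun j => subprobabilityForm n₂ j ∘ₗ LinearMap.snd ℝ _ _))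
    (Sum.elim (subprobabilityBound n₁) (subprobabilityBound n₂)) ?_ ?_ ?_
  · congr 1
    ext z
    simp only [Sum.forall, Sum.elim_inl, Sum.elim_inr, LinearMap.comp_apply, LinearMap.fst_apply,
      LinearMap.snd_apply, mem_ofPred_eq, mem_prod, forall_subprobabilityForm_le_iff]
  · exact ((isCompact_subprobabilitySimplex n₁).prod
      (isCompact_subprobabilitySimplex n₂)).inter_left Z.closed_of_finiteDimensional
  · simp
end

section
/- Let S be a semiring, A a finite set, and n₁, n₂ ∈ ℕ. For j = 1, 2 let oⱼ : (Fin nⱼ → S) →ₗ[S] S be a linear output map and for each a ∈ A let c_{j,a} : (Fin nⱼ → S) →ₗ[S] (Fin nⱼ → S) be a linear map; for a word w : List A define c_{j,w} by c_{j,[]} = id and c_{j,w ++ [a]} = c_{j,a} ∘ c_{j,w}. Suppose x₁ ∈ Fin n₁ → S and x₂ ∈ Fin n₂ → S satisfy o₁ (c_{1,w} x₁) = o₂ (c_{2,w} x₂) for every word w : List A. Let Z be the S-submodule of (Fin n₁ → S) × (Fin n₂ → S) spanned by the set {(c_{1,w} x₁, c_{2,w} x₂) | w : List A}. Then: (i)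 for every z ∈ Z, o₁ z.1 = o₂ z.2; and (ii) for every z ∈ Z and every a ∈ A, (c_{1,a} z.1, c_{2,a} z.2) ∈ Z. -/
/-- Iterated transition map of a deterministic weighted automaton: `wordMap c w x`
is `c_w x`, defined by `c_[] = id` and `c_{w ++ [a]} = c_a ∘ c_w`. -/
def wordMap {S : Type*} [Semiring S] {n : ℕ} {A : Type*}
    (c : A → ((Fin n → S) →ₗ[S] (Fin n → S))) (w : List A) (x : Fin n → S) :
    Fin n → S :=
  w.foldl (fun v a => c a v) x

theorem wordMap_append_singleton {S : Type*} [Semiring S] {n : ℕ} {A : Type*}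
    (c : A → ((Fin n → S) →ₗ[S] (Fin n → S))) (w : List A) (a : A) (x : Fin n → S) :
    wordMap c (w ++ [a]) x = c a (wordMap c w x) := by
  simp [wordMap]

/-- Lemma 1 of the paper: the `S`-submodule `Z` of `Sⁿ¹ × Sⁿ²` spanned by the
pairs `(c_{1,w} x₁, c_{2,w} x₂)` satisfies: the two output maps agree on `Z`,
and `Z` is invariant under the paired transition maps. -/
theorem span_reachable_common_coalgebra
    (S : Type*) [Semiring S] (A : Type*) [Fintype A] (n₁ n₂ : ℕ)
    (o₁ : (Fin n₁ → S) →ₗ[S] S) (o₂ : (Fin n₂ → S) →ₗ[S] S)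
    (c₁ : A → ((Fin n₁ → S) →ₗ[S] (Fin n₁ → S)))
    (c₂ : A → ((Fin n₂ → S) →ₗ[S] (Fin n₂ → S)))
    (x₁ : Fin n₁ → S) (x₂ : Fin n₂ → S)
    (htr : ∀ w : List A, o₁ (wordMap c₁ w x₁) = o₂ (wordMap c₂ w x₂)) :
    (∀ z ∈ Submodule.span S
        {z : (Fin n₁ → S) × (Fin n₂ → S) |
          ∃ w : List A, z = (wordMap c₁ w x₁, wordMap c₂ w x₂)},
        o₁ z.1 = o₂ z.2) ∧
    (∀ z ∈ Submodule.span S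
        {z : (Fin n₁ → S) × (Fin n₂ → S) |
          ∃ w : List A, z = (wordMap c₁ w x₁, wordMap c₂ w x₂)},
        ∀ a : A, (c₁ a z.1, c₂ a z.2) ∈ Submodule.span S
          {z : (Fin n₁ → S) × (Fin n₂ → S) |
            ∃ w : List A, z = (wordMap c₁ w x₁, wordMap c₂ w x₂)}) := by
  refine ⟨fun z hz => ?_, fun z hz a => ?_⟩
  · refine LinearMap.eqOn_span (f := o₁ ∘ₗ LinearMap.fst S _ _)
      (g := o₂ ∘ₗ LinearMap.snd S _ _) ?_ hz
    rintro _ ⟨w, rfl⟩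
    exact htr w
  · refine (Submodule.span_le (p := (Submodule.span S _).comap ((c₁ a).prodMap (c₂ a)))).2 ?_ hz
    rintro _ ⟨w, rfl⟩
    refine Submodule.subset_span ⟨w ++ [a], ?_⟩
    simp only [wordMap_append_singleton, LinearMap.prodMap_apply]
end

section
/- Let A be a finite set, V a real vector space, and X ⊆ V positively convex. Then the following two sets are equal: (1) the set of pairs (o, φ) ∈ ℝ × (A → V) such that 0 ≤ o ≤ 1 and for each a ∈ A there exist n_a ∈ ℕ, reals p_{a,1}, …, p_{a,n_a} ∈ [0,1] and elements x_{a,1}, …, x_{a,n_a} ∈ X with o + ∑_{a ∈ A} ∑_{j=1}^{n_a} p_{a,j} ≤ 1 and φ a = ∑_{j=1}^{n_a} p_{a,j} • x_{a,j}; and (2) the set of pairs (o, φ) ∈ ℝ × (A → V) such that 0 ≤ o ≤ 1 and there exist p : A → ℝ and x : A → V with, for each a ∈ A, 0 ≤ p a ≤ 1, x a ∈ X, φ a = p a • x a, and o + ∑_{a ∈ A} p a ≤ 1. -/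
/-- In a nonempty convex set, a nonnegative combination of points is a multiple, by the total
weight, of a single point of the set. -/
theorem Convex.exists_sum_smul_eq {ι V : Type*} [AddCommGroup V] [Module ℝ V] {X : Set V}
    (hX : Convex ℝ X) (hne : X.Nonempty) (s : Finset ι) {w : ι → ℝ} {x : ι → V}
    (hw : ∀ i ∈ s, 0 ≤ w i) (hx : ∀ i ∈ s, x i ∈ X) :
    ∃ y ∈ X, ∑ i ∈ s, w i • x i = (∑ i ∈ s, w i) • y := by
  rcases (Finset.sum_nonneg hw).eq_or_lt with h | h
  · obtain ⟨y, hy⟩ := hne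
    refine ⟨y, hy, ?_⟩
    rw [← h, zero_smul]
    refine Finset.sum_eq_zero fun i hi => ?_
    rw [(Finset.sum_eq_zero_iff_of_nonneg hw).1 h.symm i hi, zero_smul]
  · refine ⟨s.centerMass w x, hX.centerMass_mem hw h hx, ?_⟩
    rw [Finset.centerMass, smul_inv_smul₀ h.ne']

/-- Lemma 2 of the paper: the defining description of `Ĝ X` coincides with the
simplified description where each `φ a` is a single subconvex multiple `p a • x a`
of an element of `X`. -/
theorem Ghat_def_eq_simplified (A : Type*) [Fintype A]
    (V : Type*) [AddCommGroup V] [Module ℝ V]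
    (X : Set V) (hX0 : (0 : V) ∈ X) (hXc : Convex ℝ X) :
    {oφ : ℝ × (A → V) | 0 ≤ oφ.1 ∧ oφ.1 ≤ 1 ∧
      ∃ (nf : A → ℕ) (p : ∀ a, Fin (nf a) → ℝ) (x : ∀ a, Fin (nf a) → V),
        (∀ a j, 0 ≤ p a j ∧ p a j ≤ 1) ∧ (∀ a j, x a j ∈ X) ∧
        oφ.1 + ∑ a, ∑ j, p a j ≤ 1 ∧
        ∀ a, oφ.2 a = ∑ j, p a j • x a j} =
    {oφ : ℝ × (A → V) | 0 ≤ oφ.1 ∧ oφ.1 ≤ 1 ∧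
      ∃ (p : A → ℝ) (x : A → V),
        (∀ a, 0 ≤ p a ∧ p a ≤ 1 ∧ x a ∈ X ∧ oφ.2 a = p a • x a) ∧
        oφ.1 + ∑ a, p a ≤ 1} := by
  ext ⟨o, φ⟩
  simp only [Set.mem_ofPred_eq]
  refine and_congr_right fun ho => and_congr_right fun _ => ⟨?_, ?_⟩
  · rintro ⟨nf, p, x, hp, hx, hsum, hφ⟩
    choose y hyX hy using fun a => hXc.exists_sum_smul_eq ⟨0, hX0⟩ Finset.univ
      (fun j _ => (hp a j).1) (fun j _ => hx a j)
    have hnonneg : ∀ a, 0 ≤ ∑ j, p a j := fun a => Finset.sum_nonneg fun j _ => (hp a j).1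
    refine ⟨fun a => ∑ j, p a j, y,
      fun a => ⟨hnonneg a, ?_, hyX a, (hφ a).trans (hy a)⟩, hsum⟩
    have := Finset.single_le_sum (fun b _ => hnonneg b) (Finset.mem_univ a)
    linarith
  · rintro ⟨p, x, h, hsum⟩
    exact ⟨fun _ => 1, fun a _ => p a, fun a _ => x a, fun a _ => ⟨(h a).1, (h a).2.1⟩,
      fun a _ => (h a).2.2.1, by simpa using hsum, fun a => by simpa using (h a).2.2.2⟩
end

section
/- Let A be a finite set, V and W real vector spaces, X ⊆ V and Y ⊆ W positively convex subsets, and f : V → W a map defined on X which preserves subconvex combinations (f (p • x + q • y) = p • f x + q • f y for all x, y ∈ X and p, q ≥ 0 with p + q ≤ 1) and satisfies f '' X = Y. Then for every (o, ψ) ∈ Ĝ Y there exists (o, φ) ∈ Ĝ X with f (φ a) = ψ a for all a ∈ A; i.e., the map Ĝ f = id × (f ∘ ·) maps Ĝ X onto Ĝ Y. -/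
/-- The subcubic convex functor `Ĝ` on a positively convex subset `X` of a real
vector space. -/
def Ghat (A : Type*) [Fintype A] {V : Type*} [AddCommGroup V] [Module ℝ V]
    (X : Set V) : Set (ℝ × (A → V)) :=
  {oφ | 0 ≤ oφ.1 ∧ oφ.1 ≤ 1 ∧
    ∃ (p : A → ℝ) (x : A → V),
      (∀ a, 0 ≤ p a ∧ p a ≤ 1 ∧ x a ∈ X ∧ oφ.2 a = p a • x a) ∧
      oφ.1 + ∑ a, p a ≤ 1}

/-- `Ĝ` preserves surjections: if `f` maps the positively convex set `X` onto
`Y` preserving subconvex combinations, then `Ĝ f = id × (f ∘ ·)` maps `Ĝ X`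
onto `Ĝ Y`. -/
theorem Ghat_preserves_surjective (A : Type*) [Fintype A]
    (V W : Type*) [AddCommGroup V] [Module ℝ V] [AddCommGroup W] [Module ℝ W]
    (X : Set V) (hX0 : (0 : V) ∈ X) (hXc : Convex ℝ X)
    (Y : Set W) (hY0 : (0 : W) ∈ Y) (hYc : Convex ℝ Y)
    (f : V → W)
    (hf : ∀ x ∈ X, ∀ y ∈ X, ∀ p q : ℝ, 0 ≤ p → 0 ≤ q → p + q ≤ 1 →
      f (p • x + q • y) = p • f x + q • f y)
    (hsurj : f '' X = Y) :
    ∀ oψ ∈ Ghat A Y, ∃ φ : A → V,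
      (oψ.1, φ) ∈ Ghat A X ∧ ∀ a, f (φ a) = oψ.2 a := by
  rintro ⟨o, ψ⟩ ⟨ho0, ho1, p, y, hpy, hsum⟩
  have hlift : ∀ a, ∃ x ∈ X, f x = y a := fun a => by
    have hy := (hpy a).2.2.1
    rwa [← hsurj] at hy
  choose x hxX hfx using hlift
  refine ⟨fun a => p a • x a,
    ⟨ho0, ho1, p, x, fun a => ⟨(hpy a).1, (hpy a).2.1, hxX a, rfl⟩, hsum⟩, fun a => ?_⟩
  have h := hf (x a) (hxX a) 0 hX0 (p a) 0 (hpy a).1 le_rfl (by simpa using (hpy a).2.1)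
  simp only [zero_smul, add_zero] at h
  rw [h, hfx a]
  exact (hpy a).2.2.2.symm
end

section
/- Let V₁ and V₂ be real vector spaces, X ⊆ V₁ positively convex, and c : V₁ → V₂ a map such that c (p • x + q • y) = p • c x + q • c y for all x, y ∈ X and all p, q ≥ 0 with p + q ≤ 1. Then there exists an ℝ-linear map c̃ : V₁ →ₗ[ℝ] V₂ with c̃ x = c x for all x ∈ X. Moreover, if the linear span of X equals V₁, then this linear extension is unique. -/
/-- Every element of the span of the graph of a convex map on a positively convex set is, up to a
positive scalar, a difference of two points of that graph. -/
theorem exists_smul_eq_sub_of_mem_span_graph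
    {V₁ V₂ : Type*} [AddCommGroup V₁] [Module ℝ V₁] [AddCommGroup V₂] [Module ℝ V₂]
    {X : Set V₁} (hX0 : (0 : V₁) ∈ X) (hXc : Convex ℝ X) {c : V₁ → V₂}
    (hc : ∀ x ∈ X, ∀ y ∈ X, ∀ p q : ℝ, 0 ≤ p → 0 ≤ q → p + q ≤ 1 →
      c (p • x + q • y) = p • c x + q • c y)
    {z : V₁ × V₂} (hz : z ∈ Submodule.span ℝ ((fun x => (x, c x)) '' X)) :
    ∃ r : ℝ, 0 < r ∧ ∃ x ∈ X, ∃ y ∈ X, r • z = (x, c x) - (y, c y) := by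
  have hc0 : c 0 = 0 := by simpa using hc 0 hX0 0 hX0 0 0 le_rfl le_rfl (by norm_num)
  have hsmul : ∀ x ∈ X, ∀ p : ℝ, 0 ≤ p → p ≤ 1 → c (p • x) = p • c x := by
    intro x hx p hp hp1
    simpa using hc x hx 0 hX0 p 0 hp le_rfl (by simpa using hp1)
  induction hz using Submodule.span_induction with
  | mem z hz =>
    obtain ⟨x, hx, rfl⟩ := hz
    exact ⟨1, one_pos, x, hx, 0, hX0, by simp [hc0]⟩
  | zero => exact ⟨1, one_pos, 0, hX0, 0, hX0, by simp⟩
  | add z w _ _ hz hw =>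
    obtain ⟨r, hr, x, hx, y, hy, hz⟩ := hz
    obtain ⟨s, hs, x', hx', y', hy', hw⟩ := hw
    have hp : 0 ≤ s / (r + s) := by positivity
    have hq : 0 ≤ r / (r + s) := by positivity
    have hpq : s / (r + s) + r / (r + s) = 1 := by field_simp; ring
    refine ⟨r * s / (r + s), by positivity, (s / (r + s)) • x + (r / (r + s)) • x',
      hXc hx hx' hp hq hpq, (s / (r + s)) • y + (r / (r + s)) • y',
      hXc hy hy' hp hq hpq, ?_⟩
    rw [hc x hx x' hx' _ _ hp hq hpq.le, hc y hy y' hy' _ _ hp hq hpq.le]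
    have h : (r * s / (r + s)) • (z + w)
        = (s / (r + s)) • (r • z) + (r / (r + s)) • (s • w) := by
      module
    rw [h, hz, hw]
    ext <;> simp <;> module
  | smul a z _ hz =>
    obtain ⟨r, hr, x, hx, y, hy, hz⟩ := hz
    have ha : 0 < 1 + |a| := by positivity
    have hp : 0 ≤ |a| / (1 + |a|) := by positivity
    have hp1 : |a| / (1 + |a|) ≤ 1 := by rw [div_le_one ha]; linarith
    have hmem : ∀ x ∈ X, (|a| / (1 + |a|)) • x ∈ X := fun x hx =>
      hXc.smul_mem_of_zero_mem hX0 hx ⟨hp, hp1⟩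
    have h : (r / (1 + |a|)) • a • z = (a / (1 + |a|)) • (r • z) := by module
    rcases le_total 0 a with h0 | h0
    · refine ⟨r / (1 + |a|), by positivity, _, hmem x hx, _, hmem y hy, ?_⟩
      rw [hsmul x hx _ hp hp1, hsmul y hy _ hp hp1, h, hz, abs_of_nonneg h0]
      ext <;> simp <;> module
    · refine ⟨r / (1 + |a|), by positivity, _, hmem y hy, _, hmem x hx, ?_⟩
      rw [hsmul x hx _ hp hp1, hsmul y hy _ hp hp1, h, hz, abs_of_nonpos h0]
      ext <;> simp <;> module


/-- Every convex map on a positively convex subset of a real vector space has a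
linear extension; if the span of the subset is the whole space, the extension
is unique. -/
theorem convex_map_has_linear_extension
    (V₁ V₂ : Type*) [AddCommGroup V₁] [Module ℝ V₁] [AddCommGroup V₂] [Module ℝ V₂]
    (X : Set V₁) (hX0 : (0 : V₁) ∈ X) (hXc : Convex ℝ X)
    (c : V₁ → V₂)
    (hc : ∀ x ∈ X, ∀ y ∈ X, ∀ p q : ℝ, 0 ≤ p → 0 ≤ q → p + q ≤ 1 →
      c (p • x + q • y) = p • c x + q • c y) :
    ∃ ct : V₁ →ₗ[ℝ] V₂, (∀ x ∈ X, ct x = c x) ∧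
      (Submodule.span ℝ X = ⊤ →
        ∀ ct' : V₁ →ₗ[ℝ] V₂, (∀ x ∈ X, ct' x = c x) → ct' = ct) := by
  set G := Submodule.span ℝ ((fun x => (x, c x)) '' X)
  have hG : ∀ z ∈ G, z.1 = 0 → z.2 = 0 := by
    intro z hz hz1
    obtain ⟨r, hr, x, -, y, -, h⟩ := exists_smul_eq_sub_of_mem_span_graph hX0 hXc hc hz
    have h1 := congrArg Prod.fst h
    have h2 := congrArg Prod.snd h
    simp only [Prod.smul_fst, Prod.smul_snd, Prod.fst_sub, Prod.snd_sub, hz1, smul_zero] at h1 h2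
    rw [← sub_eq_zero.mp h1.symm, sub_self] at h2
    exact (smul_eq_zero.mp h2).resolve_left hr.ne'
  obtain ⟨ct, hct⟩ := LinearMap.exists_extend G.toLinearPMap.toFun
  have hext : ∀ x ∈ X, ct x = c x := by
    intro x hx
    have hmem : (x, c x) ∈ G.toLinearPMap.graph := by
      rw [Submodule.toLinearPMap_graph_eq G hG]
      exact Submodule.subset_span ⟨x, hx, rfl⟩
    obtain ⟨u, hu, hcu⟩ := (LinearPMap.mem_graph_iff _).mp hmem
    dsimp only at hu hcu
    rw [← hcu, ← hu]
    exact LinearMap.congr_fun hct u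
  exact ⟨ct, hext, fun hspan ct' hct' =>
    LinearMap.ext_on hspan fun x hx => (hct' x hx).trans (hext x hx).symm⟩
end

section
/- Let A be a finite set and X ⊆ ℝⁿ a compact positively convex subset. Then a pair (o, φ) ∈ ℝ × (A → ℝⁿ) belongs to Ĝ X if and only if: o ≥ 0; for each a ∈ A there exists s ≥ 0 with φ a ∈ s • X; and o + ∑_{a ∈ A} gauge X (φ a) ≤ 1. -/
open scoped Pointwise

/-- For a compact set, the infimum defining the gauge of a point of the cone it spans is attained. -/
theorem IsCompact.mem_gauge_smul {V : Type*} [AddCommGroup V] [Module ℝ V] [TopologicalSpace V]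
    [ContinuousSMul ℝ V] [T1Space V] {X : Set V} (hX : IsCompact X)
    {z : V} {s : ℝ} (hs : 0 ≤ s) (hz : z ∈ s • X) : z ∈ gauge X z • X := by
  have hclosed : IsClosed {t : ℝ | z ∈ t • X} := by
    have : CompactSpace X := isCompact_iff_compactSpace.mp hX
    have hpre : IsClosed {q : ℝ × X | q.1 • (q.2 : V) = z} :=
      isClosed_singleton.preimage (f := fun q : ℝ × X => q.1 • (q.2 : V)) (by fun_prop)
    convert isClosedMap_fst_of_compactSpace _ hpre using 1
    ext t
    simp [Set.mem_smul_set]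
  rcases hs.eq_or_lt with rfl | hs
  · obtain ⟨x, hx, rfl⟩ := hz
    exact ⟨x, hx, by simp⟩
  · exact closure_minimal (fun t ht => ht.2) hclosed
      (csInf_mem_closure ⟨s, hs, hz⟩ ⟨0, fun t ht => ht.1.le⟩)

/-- Lemma 3 of the paper: for a compact positively convex `X ⊆ ℝⁿ`, membership
in `Ĝ X` is characterised via the Minkowski functional (gauge) of `X`. -/
theorem mem_Ghat_iff_gauge (A : Type*) [Fintype A] (n : ℕ)
    (X : Set (Fin n → ℝ)) (hX0 : (0 : Fin n → ℝ) ∈ X) (hXc : Convex ℝ X)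
    (hXcpt : IsCompact X) (o : ℝ) (φ : A → Fin n → ℝ) :
    (o, φ) ∈ Ghat A X ↔
      0 ≤ o ∧ (∀ a, ∃ s : ℝ, 0 ≤ s ∧ φ a ∈ s • X) ∧
        o + ∑ a, gauge X (φ a) ≤ 1 := by
  constructor
  · rintro ⟨ho, -, p, x, hpx, hsum⟩
    have hmem : ∀ a, φ a ∈ p a • X := fun a => ⟨x a, (hpx a).2.2.1, (hpx a).2.2.2.symm⟩
    refine ⟨ho, fun a => ⟨p a, (hpx a).1, hmem a⟩, le_trans ?_ hsum⟩
    gcongr with a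
    exact gauge_le_of_mem (hpx a).1 (hmem a)
  · rintro ⟨ho, hcone, hsum⟩
    have hmem : ∀ a, φ a ∈ gauge X (φ a) • X := fun a => by
      obtain ⟨s, hs, hφ⟩ := hcone a
      exact hXcpt.mem_gauge_smul hs hφ
    choose x hxX hx using hmem
    have hnonneg : ∀ a, 0 ≤ gauge X (φ a) := fun a => gauge_nonneg _
    have hle : ∀ a, gauge X (φ a) ≤ ∑ b, gauge X (φ b) := fun a =>
      Finset.single_le_sum (fun b _ => hnonneg b) (Finset.mem_univ a)
    have hsum_nonneg : 0 ≤ ∑ a, gauge X (φ a) := Finset.sum_nonneg fun a _ => hnonneg a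
    exact ⟨ho, by linarith, fun a => gauge X (φ a), x,
      fun a => ⟨hnonneg a, by linarith [hle a], hxX a, (hx a).symm⟩, hsum⟩
end

section
/- Let M ⊆ ℝⁿ be nonempty, compact, and convex, and let P : ℝⁿ → Set ℝⁿ be a set-valued map such that: for every x ∈ M, P x is a nonempty convex subset of M; and the graph {(x, y) ∈ ℝⁿ × ℝⁿ | x ∈ M ∧ y ∈ P x} is a closed set. Then there exists x ∈ M with x ∈ P x. -/
open Finset

/-- No element of `V` exceeds, in every one of the orders induced by `r`, the minimum of `S`. -/
def IsUndominated {I V L : Type*} [LinearOrder L] (r : I → V → L) (S : Finset V) : Prop :=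
  ∀ y, ∃ i, ∀ x ∈ S, r i y ≤ r i x

namespace IsUndominated

variable {I V L : Type*} [LinearOrder L] {r : I → V → L}

theorem mono {S R : Finset V} (hR : IsUndominated r R) (h : S ⊆ R) : IsUndominated r S :=
  fun y => (hR y).imp fun _ hi x hx => hi x (h hx)

variable [Fintype I] [DecidableEq I] [Fintype V] [DecidableEq V]

/-- An undominated set with one element less than there are orders has exactly two undominated
one-point extensions, provided it has an element `s₀` that lies below the points `e i`. -/
theorem exists_pair {S : Finset V} (hr : ∀ i, Function.Injective (r i))
    (hS : IsUndominated r S) (hcard : #S + 1 = Fintype.card I) {s₀ : V} (hs₀ : s₀ ∈ S)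
    {e : I → V} (he : ∀ i j, j ≠ i → r j s₀ < r j (e i)) :
    ∃ v w, v ≠ w ∧ v ∉ S ∧ w ∉ S ∧
      ∀ u, u ∉ S → (IsUndominated r (insert u S) ↔ u = v ∨ u = w) := by
  have hmin (i : I) : ∃ m ∈ S, ∀ x ∈ S, r i m ≤ r i x := S.exists_min_image (r i) ⟨s₀, hs₀⟩
  choose m hmS hm using hmin
  have heq {i s} (hs : s ∈ S) (h : ∀ x ∈ S, r i s ≤ r i x) : m i = s :=
    hr i (le_antisymm (hm i s hs) (h _ (hmS i)))
  have hsurj {s} (hs : s ∈ S) : ∃ i, m i = s := (hS s).imp fun i hi => heq hs hi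
  obtain ⟨a, -, b, -, hab, hmab⟩ := exists_ne_map_eq_of_card_lt_of_maps_to
    (s := univ) (t := S) (f := m) (by rw [card_univ]; omega) (fun i _ => hmS i)
  have hinj {i} (h : ∀ s ∈ S, ∃ j, j ≠ i ∧ m j = s) : Set.InjOn m {j | j ≠ i} := by
    have := injOn_of_surjOn_of_card_le (s := univ.erase i) (t := S) m (fun j _ => hmS j)
      (fun s hs => by
        obtain ⟨j, hj, rfl⟩ := h s hs
        exact ⟨j, by simpa using hj, rfl⟩)
      (by rw [card_erase_of_mem (mem_univ i), card_univ]; omega)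
    intro j hj k hk
    exact this (by simpa using hj) (by simpa using hk)
  let Q (i : I) : Finset V := univ.filter fun y => ∀ j, j ≠ i → r j (m j) < r j y
  have hQ (i : I) : (Q i).Nonempty :=
    ⟨e i, by simpa [Q] using fun j hj => (hm j s₀ hs₀).trans_lt (he i j hj)⟩
  have hmax (i : I) : ∃ y ∈ Q i, ∀ z ∈ Q i, r i z ≤ r i y := (Q i).exists_max_image (r i) (hQ i)
  choose q hqQ hq using hmax
  have hQ' {i j y} (hy : y ∈ Q i) (hj : j ≠ i) : r j (m j) < r j y := by
    simp only [Q, mem_filter] at hy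
    exact hy.2 j hj
  have hQS {i y} (hy : y ∈ Q i) : ∀ x ∈ S, r i y ≤ r i x := by
    obtain ⟨j, hj⟩ := hS y
    obtain rfl : j = i := by_contra fun h => (hQ' hy h).not_ge (hj _ (hmS j))
    exact hj
  have hnot {i k} (hik : k ≠ i) (hmk : m i = m k) : q i ∉ S := by
    intro h
    obtain ⟨j, hj⟩ := hsurj h
    by_cases hji : j = i
    · subst hji
      have := hQ' (hqQ j) hik
      rw [← hmk, hj] at this
      exact this.false
    · have := hQ' (hqQ i) hji
      rw [hj] at this
      exact this.false
  have hins (i : I) : IsUndominated r (insert (q i) S) := by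
    intro z
    by_cases hz : z ∈ Q i
    · refine ⟨i, fun x hx => ?_⟩
      rcases mem_insert.1 hx with rfl | hx
      · exact hq i z hz
      · exact hQS hz x hx
    · simp only [Q, mem_filter, mem_univ, true_and, not_forall, not_lt] at hz
      obtain ⟨j, hji, hj⟩ := hz
      refine ⟨j, fun x hx => ?_⟩
      rcases mem_insert.1 hx with rfl | hx
      · exact hj.trans (hQ' (hqQ i) hji).le
      · exact hj.trans (hm j x hx)
  refine ⟨q a, q b, fun h => ?_, hnot hab.symm hmab, hnot hab hmab.symm,
    fun u hu => ⟨fun h => ?_, ?_⟩⟩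
  · obtain ⟨j, hj⟩ := hS (q a)
    by_cases hja : j = a
    · have : j ≠ b := hja ▸ hab
      exact (hQ' (h ▸ hqQ b) this).not_ge (hj _ (hmS j))
    · exact (hQ' (hqQ a) hja).not_ge (hj _ (hmS j))
  · obtain ⟨i, hi⟩ := h u
    have hcov : ∀ s ∈ S, ∃ j, j ≠ i ∧ m j = s ∧ r j s ≤ r j u := by
      intro s hs
      obtain ⟨j, hj⟩ := h s
      refine ⟨j, ?_, heq hs fun x hx => hj x (mem_insert_of_mem hx), hj u (mem_insert_self ..)⟩
      rintro rfl
      have := hr j (le_antisymm (hj u (mem_insert_self ..)) (hi s (mem_insert_of_mem hs)))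
      exact hu (this ▸ hs)
    have hinj' := hinj fun s hs => (hcov s hs).imp fun j hj => ⟨hj.1, hj.2.1⟩
    have huQ : u ∈ Q i := by
      simp only [Q, mem_filter, mem_univ, true_and]
      intro j hj
      obtain ⟨k, hk, hmk, hle⟩ := hcov (m j) (hmS j)
      obtain rfl : k = j := hinj' hk hj hmk
      exact lt_of_le_of_ne hle fun h => hu (hr k h ▸ hmS k)
    have huq : u = q i := by
      obtain ⟨j, hj⟩ := h (q i)
      obtain rfl : j = i := by_contra fun h =>
        (hQ' (hqQ i) h).not_ge (hj _ (mem_insert_of_mem (hmS j)))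
      exact hr j (le_antisymm (hq j u huQ) (hj u (mem_insert_self ..)))
    have : i = a ∨ i = b := by
      by_contra! hi
      exact hab (hinj' hi.1.symm hi.2.symm hmab)
    rcases this with rfl | rfl
    · exact Or.inl huq
    · exact Or.inr huq
  · rintro (rfl | rfl)
    exacts [hins a, hins b]

/-- A set of full size whose colours omit exactly one colour has exactly two subsets
with one element less and with the same colours. -/
theorem card_filter_subset_image_eq {R : Finset V} {c : V → I} {i₀ : I}
    (hcard : #R = Fintype.card I) (hR : R.image c = univ.erase i₀) :
    #{S : Finset V | S ⊆ R ∧ #S + 1 = Fintype.card I ∧ S.image c = univ.erase i₀} = 2 := by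
  have hpos : 0 < Fintype.card I := Fintype.card_pos_iff.2 ⟨i₀⟩
  have hIcard : #(univ.erase i₀ : Finset I) + 1 = Fintype.card I := by
    rw [card_erase_of_mem (mem_univ _), card_univ]; omega
  obtain ⟨x, hx, y, hy, hxy, hcxy⟩ := exists_ne_map_eq_of_card_lt_of_maps_to
    (s := R) (t := univ.erase i₀) (f := c) (by omega)
    (fun z hz => by rw [← hR]; exact mem_coe.2 (mem_image_of_mem c hz))
  have key : ∀ x ∈ R, ∀ y ∈ R, x ≠ y → c x = c y →
      (R.erase x).image c = univ.erase i₀ := by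
    intro x hx y hy hxy hc
    rw [← hR]
    refine (image_subset_image (erase_subset x R)).antisymm fun k hk => ?_
    obtain ⟨z, hz, rfl⟩ := mem_image.1 hk
    by_cases hzx : z = x
    · exact mem_image.2 ⟨y, mem_erase.2 ⟨hxy.symm, hy⟩, by rw [hzx, hc]⟩
    · exact mem_image_of_mem c (mem_erase.2 ⟨hzx, hz⟩)
  have hne : R.erase x ≠ R.erase y := fun h =>
    notMem_erase x R (h ▸ mem_erase.2 ⟨hxy, hx⟩)
  rw [← card_pair hne]
  congr 1
  ext S
  simp only [mem_filter, mem_univ, true_and, mem_insert, mem_singleton]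
  constructor
  · rintro ⟨hSR, hSc, hSi⟩
    have hinj : Set.InjOn c S := card_image_iff.1 (by rw [hSi]; omega)
    have hS {z} (hz : z ∈ R) (hzS : z ∉ S) : S = R.erase z := by
      refine eq_of_subset_of_card_le (fun w hw => mem_erase.2 ⟨?_, hSR hw⟩) ?_
      · rintro rfl; exact hzS hw
      · rw [card_erase_of_mem hz]; omega
    by_cases hxS : x ∈ S
    · exact Or.inr (hS hy fun hyS => hxy (hinj hxS hyS hcxy))
    · exact Or.inl (hS hx hxS)
  · rintro (rfl | rfl)
    · exact ⟨erase_subset .., by rw [card_erase_of_mem hx]; omega, key x hx y hy hxy hcxy⟩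
    · exact ⟨erase_subset .., by rw [card_erase_of_mem hy]; omega,
        key y hy x hx hxy.symm hcxy.symm⟩

/-- **Scarf's lemma**: if `e i` is the least element of the `i`-th order and lies above the
elements outside the range of `e` in all other orders, then every colouring that gives `e i` the
colour `i` has an undominated set with all colours. -/
theorem exists_image_eq_univ [Nonempty I] (hr : ∀ i, Function.Injective (r i)) (e : I → V)
    (hbot : ∀ i v, r i (e i) ≤ r i v)
    (htop : ∀ v, v ∉ Set.range e → ∀ i j, j ≠ i → r j v < r j (e i))
    (hV : ∃ v, v ∉ Set.range e) (c : V → I) (hc : ∀ i, c (e i) = i) :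
    ∃ R, IsUndominated r R ∧ R.image c = univ := by
  classical
  by_contra! hcon
  obtain ⟨i₀⟩ := ‹Nonempty I›
  have hpos : 0 < Fintype.card I := Fintype.card_pos_iff.2 ⟨i₀⟩
  have heinj : Function.Injective e := Function.LeftInverse.injective hc
  let rooms : Finset (Finset V) := {R | #R = Fintype.card I ∧ IsUndominated r R}
  let doors : Finset (Finset V) :=
    {S | #S + 1 = Fintype.card I ∧ IsUndominated r S ∧ S.image c = univ.erase i₀}
  have hcount := sum_card_bipartiteAbove_eq_sum_card_bipartiteBelow
    (s := doors) (t := rooms) (fun S R => S ⊆ R)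
  have hright : Even (∑ R ∈ rooms, #(doors.bipartiteBelow (fun S R => S ⊆ R) R)) := by
    refine even_sum _ fun R hR => ?_
    simp only [rooms, mem_filter, mem_univ, true_and] at hR
    by_cases hRi : R.image c = univ.erase i₀
    · have : doors.bipartiteBelow (fun S R => S ⊆ R) R =
          ({S | S ⊆ R ∧ #S + 1 = Fintype.card I ∧ S.image c = univ.erase i₀} :
            Finset (Finset V)) := by
        ext S
        simp only [bipartiteBelow, doors, mem_filter, mem_univ, true_and]
        exact ⟨fun h => ⟨h.2, h.1.1, h.1.2.2⟩, fun h => ⟨⟨h.2.1, hR.2.mono h.1, h.2.2⟩, h.1⟩⟩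
      rw [this, card_filter_subset_image_eq hR.1 hRi]
      exact even_two
    · have : doors.bipartiteBelow (fun S R => S ⊆ R) R = ∅ := by
        refine filter_eq_empty_iff.2 fun S hS hSR => ?_
        simp only [doors, mem_filter, mem_univ, true_and] at hS
        have h1 := image_subset_image (f := c) hSR
        rw [hS.2.2] at h1
        by_cases hi : i₀ ∈ R.image c
        · refine hcon R hR.2 (eq_univ_iff_forall.2 fun i => ?_)
          by_cases h : i = i₀
          · exact h ▸ hi
          · exact h1 (by simp [h])
        · exact hRi (h1.antisymm' fun i hi' => by
            simp only [mem_erase, mem_univ, and_true]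
            rintro rfl
            exact hi hi')
      simp [this]
  let S₀ : Finset V := (univ.erase i₀).image e
  have hS₀card : #S₀ + 1 = Fintype.card I := by
    rw [card_image_of_injective _ heinj, card_erase_of_mem (mem_univ _), card_univ]; omega
  have hS₀ : S₀ ∈ doors := by
    simp only [doors, mem_filter, mem_univ, true_and]
    refine ⟨hS₀card, fun y => ?_, ?_⟩
    · by_cases hy : y ∈ Set.range e
      · obtain ⟨i, rfl⟩ := hy
        exact ⟨i, fun x _ => hbot i x⟩
      · refine ⟨i₀, fun x hx => ?_⟩
        obtain ⟨j, hj, rfl⟩ := mem_image.1 hx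
        exact (htop y hy j i₀ (ne_of_mem_erase hj).symm).le
    · simp [S₀, image_image, Function.comp_def, hc]
  have hinsert {S R : Finset V} (hS : S ∈ doors) (hR : R ∈ rooms) (h : S ⊆ R) :
      ∃ v, v ∉ S ∧ insert v S = R := by
    simp only [doors, rooms, mem_filter, mem_univ, true_and] at hS hR
    simpa using exists_eq_insert_iff.2 ⟨h, by omega⟩
  have hroom {S : Finset V} {v : V} (hS : S ∈ doors) (hv : v ∉ S)
      (h : IsUndominated r (insert v S)) : insert v S ∈ rooms := by
    simp only [doors, rooms, mem_filter, mem_univ, true_and] at hS ⊢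
    exact ⟨by rw [card_insert_of_notMem hv, hS.1], h⟩
  have hone : #(rooms.bipartiteAbove (fun S R => S ⊆ R) S₀) = 1 := by
    obtain ⟨v₀, hv₀⟩ := hV
    obtain ⟨t, ht, htmax⟩ := exists_max_image ({v | v ∉ Set.range e} : Finset V) (r i₀)
      ⟨v₀, by simpa using hv₀⟩
    simp only [mem_filter, mem_univ, true_and] at ht htmax
    have htS : t ∉ S₀ := fun h => ht (by
      obtain ⟨j, -, hj⟩ := mem_image.1 h
      exact ⟨j, hj⟩)
    have hmem {j} (hj : j ≠ i₀) : e j ∈ S₀ := mem_image_of_mem e (by simp [hj])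
    refine card_eq_one.2 ⟨insert t S₀, ?_⟩
    ext R
    simp only [bipartiteAbove, mem_filter, mem_singleton]
    constructor
    · rintro ⟨hR, hSR⟩
      obtain ⟨v, hv, rfl⟩ := hinsert hS₀ hR hSR
      simp only [rooms, mem_filter, mem_univ, true_and] at hR
      obtain ⟨j, hj⟩ := hR.2 t
      have hlt {k x} (h : r k x ≤ r k (e k)) : x ∈ Set.range e :=
        ⟨k, hr k (le_antisymm (hbot k x) h)⟩
      obtain rfl : j = i₀ := by_contra fun h =>
        ht (hlt (hj _ (mem_insert_of_mem (hmem h))))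
      have hvt := hj v (mem_insert_self ..)
      by_cases hve : v ∈ Set.range e
      · obtain ⟨k, rfl⟩ := hve
        by_cases hk : k = j
        · exact absurd (hlt (hk ▸ hvt)) ht
        · exact absurd (hmem hk) hv
      · rw [hr j (le_antisymm hvt (htmax v hve))]
    · rintro rfl
      refine ⟨hroom hS₀ htS fun y => ?_, subset_insert ..⟩
      by_cases hy : y ∈ Set.range e
      · obtain ⟨i, rfl⟩ := hy
        exact ⟨i, fun x _ => hbot i x⟩
      · refine ⟨i₀, fun x hx => ?_⟩
        rcases mem_insert.1 hx with rfl | hx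
        · exact htmax y hy
        · obtain ⟨j, hj, rfl⟩ := mem_image.1 hx
          exact (htop y hy j i₀ (ne_of_mem_erase hj).symm).le
  have htwo : ∀ S ∈ doors.erase S₀, Even #(rooms.bipartiteAbove (fun S R => S ⊆ R) S) := by
    intro S hS
    obtain ⟨hne, hSd⟩ := mem_erase.1 hS
    have hS' := hSd
    simp only [doors, mem_filter, mem_univ, true_and] at hS'
    have : ∃ s ∈ S, s ∉ Set.range e := by
      by_contra! h
      refine hne (eq_of_subset_of_card_le (fun s hs => ?_) (by omega))
      obtain ⟨i, rfl⟩ := h s hs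
      refine mem_image_of_mem e ?_
      rw [← hS'.2.2]
      exact mem_image.2 ⟨_, hs, hc i⟩
    obtain ⟨s, hs, hse⟩ := this
    obtain ⟨v, w, hvw, hv, hw, hiff⟩ := exists_pair hr hS'.2.1 hS'.1 hs (htop s hse)
    have : rooms.bipartiteAbove (fun S R => S ⊆ R) S = {insert v S, insert w S} := by
      ext R
      simp only [bipartiteAbove, mem_filter, mem_insert, mem_singleton]
      constructor
      · rintro ⟨hR, hSR⟩
        obtain ⟨u, hu, rfl⟩ := hinsert hSd hR hSR
        simp only [rooms, mem_filter, mem_univ, true_and] at hR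
        rcases (hiff u hu).1 hR.2 with rfl | rfl <;> simp
      · rintro (rfl | rfl)
        · exact ⟨hroom hSd hv ((hiff v hv).2 (Or.inl rfl)), subset_insert ..⟩
        · exact ⟨hroom hSd hw ((hiff w hw).2 (Or.inr rfl)), subset_insert ..⟩
    rw [this, card_pair fun h => ?_]
    · exact even_two
    · have : v ∈ insert w S := h ▸ mem_insert_self v S
      exact (mem_insert.1 this).elim hvw hv
  rw [← hcount, ← add_sum_erase _ _ hS₀, hone] at hright
  exact absurd hright (by
    rw [Nat.not_even_iff_odd, add_comm]
    exact (even_sum _ htwo).add_one)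

end IsUndominated

/-- Every colouring of the lattice points of a dilated simplex has points of all colours, up to
colours of vanishing coordinates, that are close to each other. -/
theorem exists_le_of_lattice_colouring {I : Type*} [Fintype I] [Nonempty I] (N : ℕ)
    (col : (I → ℕ) → I) :
    ∃ m : I → ℕ, N ≤ ∑ i, m i + Fintype.card I ∧
      ∀ i, m i = 0 ∨ ∃ x : I → ℕ, ∑ k, x k = N ∧ col x = i ∧ ∀ k, m k ≤ x k := by
  classical
  let T := {x : I → ℕ // x ∈ piAntidiag (univ : Finset I) N}
  have hT (x : T) : ∑ k, x.1 k = N := (mem_piAntidiag.1 x.2).1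
  let w (i : I) : T ⊕ I → ℕ := Sum.elim (fun x => x.1 i + 1) fun j => if j = i then 0 else N + 2
  let r (i : I) (v : T ⊕ I) : ℕ ×ₗ Fin (Fintype.card (T ⊕ I)) :=
    toLex (w i v, Fintype.equivFin _ v)
  have hr (i : I) : Function.Injective (r i) := fun u v h => by
    simpa [r] using congrArg (fun p => (ofLex p).2) h
  have hlt {i u v} (h : w i u < w i v) : r i u < r i v := Prod.Lex.toLex_lt_toLex.2 (Or.inl h)
  have hle {i u v} (h : r i u ≤ r i v) : w i u ≤ w i v := not_lt.1 fun h' => (hlt h').not_ge h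
  obtain ⟨R, hR, hRc⟩ := IsUndominated.exists_image_eq_univ hr Sum.inr
    (fun i v => by
      by_cases h : v = Sum.inr i
      · rw [h]
      · refine (hlt ?_).le
        rcases v with x | j
        · simp [w]
        · have : j ≠ i := fun hj => h (hj ▸ rfl)
          simp [w, this])
    (fun v hv i j hj => by
      rcases v with x | k
      · refine hlt ?_
        have : x.1 j ≤ N :=
          (single_le_sum (f := x.1) (fun _ _ => Nat.zero_le _) (mem_univ j)).trans_eq (hT x)
        simp only [w, Sum.elim_inl, Sum.elim_inr, if_neg hj.symm]
        omega
      · exact absurd ⟨k, rfl⟩ hv)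
    ⟨Sum.inl ⟨Pi.single (Classical.arbitrary I) N, by simp⟩, by simp⟩
    (Sum.elim (fun x => col x.1) id) (fun _ => rfl)
  have hcol (i : I) (hi : Sum.inr i ∉ R) : ∃ x : T, Sum.inl x ∈ R ∧ col x.1 = i := by
    obtain ⟨x | j, hx, rfl⟩ := mem_image.1 (hRc ▸ mem_univ i)
    · exact ⟨x, hx, rfl⟩
    · exact absurd hx hi
  have hm (i : I) : ∃ m : ℕ, (Sum.inr i ∈ R ∧ m = 0) ∨ (Sum.inr i ∉ R ∧
      (∃ x : T, Sum.inl x ∈ R ∧ x.1 i = m) ∧ ∀ x : T, Sum.inl x ∈ R → m ≤ x.1 i) := by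
    by_cases hi : Sum.inr i ∈ R
    · exact ⟨0, Or.inl ⟨hi, rfl⟩⟩
    · obtain ⟨x₀, hx₀, -⟩ := hcol i hi
      obtain ⟨x, hx, hmin⟩ := exists_min_image ({x | Sum.inl x ∈ R} : Finset T) (fun x => x.1 i)
        ⟨x₀, by simpa using hx₀⟩
      simp only [mem_filter, mem_univ, true_and] at hx hmin
      exact ⟨x.1 i, Or.inr ⟨hi, ⟨x, hx, rfl⟩, hmin⟩⟩
  choose m hm using hm
  refine ⟨m, ?_, fun i => ?_⟩
  · by_contra! hN
    let i₀ := Classical.arbitrary I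
    let t (i : I) : ℕ := m i + 1 + if i = i₀ then N - (∑ i, m i + Fintype.card I) else 0
    have ht : ∑ i, t i = N := by
      simp only [t, sum_add_distrib, sum_ite_eq', mem_univ, if_true, sum_const, card_univ,
        smul_eq_mul, mul_one]
      omega
    obtain ⟨i, hi⟩ := hR (Sum.inl ⟨t, by simpa using ht⟩)
    rcases hm i with ⟨h, -⟩ | ⟨-, ⟨x, hx, hxm⟩, -⟩
    · simpa [w] using hle (hi _ h)
    · have : t i + 1 ≤ x.1 i + 1 := hle (hi _ hx)
      simp only [t] at this
      omega
  · rcases hm i with ⟨-, h⟩ | ⟨h, -⟩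
    · exact Or.inl h
    · obtain ⟨x, hx, hxi⟩ := hcol i h
      refine Or.inr ⟨x.1, hT x, hxi, fun k => ?_⟩
      rcases hm k with ⟨-, hk⟩ | ⟨-, -, hk⟩
      · exact hk ▸ Nat.zero_le _
      · exact hk x hx

/-- A continuous self-map of the standard simplex has approximate fixed points. -/
theorem exists_le_apply_add_of_mapsTo_stdSimplex {I : Type*} [Fintype I] [Nonempty I]
    {f : (I → ℝ) → I → ℝ} (hf : ContinuousOn f (stdSimplex ℝ I))
    (hmaps : Set.MapsTo f (stdSimplex ℝ I) (stdSimplex ℝ I)) {ε : ℝ} (hε : 0 < ε) :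
    ∃ z ∈ stdSimplex ℝ I, ∀ i, z i ≤ f z i + ε := by
  have huc := (isCompact_stdSimplex ℝ I).uniformContinuousOn_of_continuous hf
  obtain ⟨δ, hδ, hfδ⟩ := Metric.uniformContinuousOn_iff.1 huc (ε / 2) (half_pos hε)
  set d := Fintype.card I
  obtain ⟨N, hN⟩ := exists_nat_gt (max (d : ℝ) (max (d / δ) (d / (ε / 2))))
  simp only [max_lt_iff] at hN
  obtain ⟨hdN, hNδ, hNε⟩ := hN
  have hN0 : (0 : ℝ) < N := (Nat.cast_nonneg d).trans_lt hdN
  rw [div_lt_iff₀ hδ, mul_comm, ← div_lt_iff₀ hN0] at hNδ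
  rw [div_lt_iff₀ (half_pos hε), mul_comm, ← div_lt_iff₀ hN0] at hNε
  let p (x : I → ℕ) (i : I) : ℝ := x i / N
  have hp {x : I → ℕ} (hx : ∑ k, x k = N) : p x ∈ stdSimplex ℝ I := by
    refine ⟨fun i => by positivity, ?_⟩
    rw [← sum_div, ← Nat.cast_sum, hx, div_self hN0.ne']
  have hcol (x : I → ℕ) : ∃ i, ∑ k, x k = N → p x i ≤ f (p x) i := by
    by_cases hx : ∑ k, x k = N
    · obtain ⟨i, -, hi⟩ := exists_le_of_sum_le (s := univ) (f := p x) (g := f (p x)) univ_nonempty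
        (by rw [(hp hx).2, (hmaps (hp hx)).2])
      exact ⟨i, fun _ => hi⟩
    · exact ⟨Classical.arbitrary I, fun h => absurd h hx⟩
  choose col hcol using hcol
  obtain ⟨m, hmN, hm⟩ := exists_le_of_lattice_colouring N col
  have hbound {x : I → ℕ} (hx : ∑ k, x k = N) (hmx : ∀ k, m k ≤ x k) (k : I) :
      x k ≤ m k + d := by
    have h1 : ∑ i, (x i - m i) + ∑ i, m i = N := by
      rw [← sum_add_distrib, ← hx]
      exact sum_congr rfl fun i _ => Nat.sub_add_cancel (hmx i)
    have h2 := single_le_sum (f := fun i => x i - m i) (fun _ _ => Nat.zero_le _) (mem_univ k)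
    omega
  have hex : ∃ i, m i ≠ 0 := by
    by_contra! h
    simp only [h, sum_const_zero, zero_add] at hmN
    exact hdN.not_ge (by exact_mod_cast hmN)
  obtain ⟨i₀, hi₀⟩ := hex
  obtain ⟨x₀, hx₀, -, hmx₀⟩ := (hm i₀).resolve_left hi₀
  refine ⟨p x₀, hp hx₀, fun i => ?_⟩
  rcases hm i with hi | ⟨x, hx, hxi, hmx⟩
  · have h1 : p x₀ i ≤ d / N := by
      have := hbound hx₀ hmx₀ i
      rw [hi, zero_add] at this
      exact div_le_div_of_nonneg_right (by exact_mod_cast this) hN0.le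
    have := (hmaps (hp hx₀)).1 i
    linarith
  · have hdist (k : I) : |p x₀ k - p x k| ≤ d / N := by
      have h1 : (x k : ℝ) ≤ m k + d := by exact_mod_cast hbound hx hmx k
      have h2 : (x₀ k : ℝ) ≤ m k + d := by exact_mod_cast hbound hx₀ hmx₀ k
      have h3 : (m k : ℝ) ≤ x k := by exact_mod_cast hmx k
      have h4 : (m k : ℝ) ≤ x₀ k := by exact_mod_cast hmx₀ k
      rw [← sub_div, abs_div, abs_of_pos hN0]
      exact div_le_div_of_nonneg_right (abs_le.2 ⟨by linarith, by linarith⟩) hN0.le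
    have hclose : dist (p x₀) (p x) < δ :=
      ((dist_pi_le_iff (by positivity)).2 hdist).trans_lt hNδ
    have h1 := (dist_le_pi_dist _ _ i).trans_lt (hfδ _ (hp hx₀) _ (hp hx) hclose)
    have h2 := hcol x hx
    rw [hxi] at h2
    have h3 := (abs_le.1 (hdist i)).2
    rw [Real.dist_eq] at h1
    have h4 := (abs_lt.1 h1).1
    linarith

/-- **Brouwer's fixed point theorem** for the standard simplex. -/
theorem exists_mem_stdSimplex_apply_eq {I : Type*} [Fintype I] [Nonempty I]
    {f : (I → ℝ) → I → ℝ} (hf : ContinuousOn f (stdSimplex ℝ I))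
    (hmaps : Set.MapsTo f (stdSimplex ℝ I) (stdSimplex ℝ I)) :
    ∃ x ∈ stdSimplex ℝ I, f x = x := by
  have hcont : ContinuousOn (fun x => ∑ i, max (x i - f x i) 0) (stdSimplex ℝ I) := by
    refine continuousOn_finsetSum _ fun i _ => ?_
    exact ((continuous_apply i).continuousOn.sub
      ((continuous_apply i).comp_continuousOn hf)).sup continuousOn_const
  obtain ⟨z₁, hz₁, -⟩ := exists_le_apply_add_of_mapsTo_stdSimplex hf hmaps one_pos
  obtain ⟨x, hx, hmin⟩ := (isCompact_stdSimplex ℝ I).exists_isMinOn ⟨z₁, hz₁⟩ hcont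
  have hle : ∑ i, max (x i - f x i) 0 ≤ 0 := by
    refine le_of_forall_pos_le_add fun ε hε => ?_
    have hd : (0 : ℝ) < Fintype.card I := by exact_mod_cast Fintype.card_pos
    obtain ⟨z, hz, hzε⟩ := exists_le_apply_add_of_mapsTo_stdSimplex hf hmaps (div_pos hε hd)
    calc _ ≤ ∑ i, max (z i - f z i) 0 := hmin hz
      _ ≤ ∑ _i : I, ε / Fintype.card I :=
        sum_le_sum fun i _ => max_le (by linarith [hzε i]) (by positivity)
      _ = 0 + ε := by
        rw [sum_const, card_univ, nsmul_eq_mul, mul_div_cancel₀ _ hd.ne', zero_add]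
  have hxf (i : I) : x i ≤ f x i := by
    have h := single_le_sum (f := fun i => max (x i - f x i) 0) (fun _ _ => le_max_right _ _)
      (mem_univ i)
    have := (le_max_left (x i - f x i) 0).trans (h.trans hle)
    linarith
  refine ⟨x, hx, funext fun i => ?_⟩
  exact ((sum_eq_sum_iff_of_le fun i _ => hxf i).1
    (by rw [hx.2, (hmaps hx).2]) i (mem_univ i)).symm

/-- A set-valued map with compact domain and closed graph is upper hemicontinuous. -/
theorem exists_forall_values_subset_thickening {E : Type*} [MetricSpace E] {M : Set E}
    {P : E → Set E} (hcpt : IsCompact M) (hP : ∀ x ∈ M, P x ⊆ M)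
    (hgraph : IsClosed {p : E × E | p.1 ∈ M ∧ p.2 ∈ P p.1}) (x : E) {δ : ℝ} (hδ : 0 < δ) :
    ∃ η > 0, ∀ z ∈ M, dist z x < η → P z ⊆ Metric.thickening δ (P x) := by
  let K : Set (E × E) := {p | p.1 ∈ M ∧ p.2 ∈ P p.1} ∩ Prod.snd ⁻¹' (Metric.thickening δ (P x))ᶜ
  have hK : IsCompact K := (hcpt.prod hcpt).of_isClosed_subset
    (hgraph.inter (Metric.isOpen_thickening.isClosed_compl.preimage continuous_snd))
    fun p hp => ⟨hp.1.1, hP _ hp.1.1 hp.1.2⟩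
  have hx : x ∉ Prod.fst '' K := by
    rintro ⟨p, ⟨⟨-, hp⟩, hp'⟩, rfl⟩
    exact hp' (Metric.self_subset_thickening hδ _ hp)
  obtain ⟨η, hη, hball⟩ := Metric.isOpen_iff.1
    (hK.image continuous_fst).isClosed.isOpen_compl x hx
  refine ⟨η, hη, fun z hz hzx y hy => ?_⟩
  by_contra h
  exact hball hzx ⟨(z, y), ⟨⟨hz, hy⟩, h⟩, rfl⟩

section Kakutani

variable {E : Type*} [NormedAddCommGroup E] [NormedSpace ℝ E] {M : Set E} {P : E → Set E}

/-- Approximate fixed points of a set-valued map with nonempty values, without any continuity. -/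
theorem exists_mem_convexHull_values_near (hne : M.Nonempty) (hcpt : IsCompact M)
    (hconv : Convex ℝ M) (hP : ∀ x ∈ M, (P x).Nonempty ∧ P x ⊆ M) {ε : ℝ} (hε : 0 < ε) :
    ∃ x ∈ M, x ∈ convexHull ℝ {y | ∃ z ∈ M, dist x z < ε ∧ y ∈ P z} := by
  obtain ⟨t, htM, htfin, htcov⟩ := hcpt.finite_cover_balls hε
  have := htfin.fintype
  have hcov {x} (hx : x ∈ M) : ∃ j : t, dist x j < ε := by
    simpa using htcov hx
  have : Nonempty t := (hcov hne.some_mem).nonempty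
  choose! s hs using fun z (hz : z ∈ M) => (hP z hz).1
  let φ (j : t) (x : E) : ℝ := max (ε - dist x j) 0
  have hφ (j : t) (x : E) : 0 ≤ φ j x := le_max_right _ _
  have hφc (j : t) : Continuous (φ j) := by fun_prop
  have hsum {x} (hx : x ∈ M) : 0 < ∑ j, φ j x := by
    obtain ⟨j, hj⟩ := hcov hx
    exact sum_pos' (fun j _ => hφ j x) ⟨j, mem_univ j, lt_max_of_lt_left (sub_pos.2 hj)⟩
  let g (a : t → ℝ) : E := ∑ j, a j • s j
  have hg {a} (ha : a ∈ stdSimplex ℝ t) : g a ∈ M :=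
    hconv.sum_mem (fun j _ => ha.1 j) ha.2 fun j _ => (hP j (htM j.2)).2 (hs j (htM j.2))
  have hgc : Continuous g := by fun_prop
  obtain ⟨a, ha, hfix⟩ := exists_mem_stdSimplex_apply_eq
    (f := fun a j => φ j (g a) / ∑ k, φ k (g a))
    (continuousOn_pi.2 fun j => ((hφc j).comp hgc).continuousOn.div
      (continuous_finsetSum _ fun k _ => (hφc k).comp hgc).continuousOn
      fun a ha => (hsum (hg ha)).ne')
    (fun a ha => ⟨fun j => div_nonneg (hφ j _) (hsum (hg ha)).le, by
      rw [← sum_div, div_self (hsum (hg ha)).ne']⟩)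
  refine ⟨g a, hg ha, ?_⟩
  have hzero {j : t} (hj : a j ≠ 0) : dist (g a) j < ε := by
    by_contra! h
    refine hj ?_
    rw [← congrFun hfix j]
    simp [φ, h]
  have hsupp : ∑ j with a j ≠ 0, a j • s j = g a :=
    sum_filter_of_ne fun j _ h h0 => h (by rw [h0, zero_smul])
  refine Set.mem_of_eq_of_mem hsupp.symm <| (convex_convexHull ℝ _).sum_mem
    (fun j _ => ha.1 j) ?_ fun j hj => subset_convexHull ℝ _ ?_
  · rw [sum_filter_ne_zero, ha.2]
  · exact ⟨j, htM j.2, hzero (mem_filter.1 hj).2, hs j (htM j.2)⟩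

/-- **Kakutani's fixed point theorem** in a real normed space. -/
theorem IsCompact.exists_mem_of_isClosed_graph (hcpt : IsCompact M) (hne : M.Nonempty)
    (hconv : Convex ℝ M) (hP : ∀ x ∈ M, (P x).Nonempty ∧ Convex ℝ (P x) ∧ P x ⊆ M)
    (hgraph : IsClosed {p : E × E | p.1 ∈ M ∧ p.2 ∈ P p.1}) : ∃ x ∈ M, x ∈ P x := by
  have hpos (k : ℕ) : (0 : ℝ) < 1 / (k + 1) := Nat.one_div_pos_of_nat
  choose u huM hu using fun k : ℕ => exists_mem_convexHull_values_near hne hcpt hconv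
    (fun x hx => ⟨(hP x hx).1, (hP x hx).2.2⟩) (hpos k)
  obtain ⟨x, hx, ψ, hψ, hlim⟩ := hcpt.tendsto_subseq huM
  have hclosed : IsClosed (P x) := by
    have := hgraph.preimage (Continuous.prodMk_right x)
    simpa [hx] using this
  refine ⟨x, hx, ?_⟩
  rw [← hclosed.closure_eq, Metric.closure_eq_iInter_cthickening, Set.mem_iInter₂]
  intro δ hδ
  obtain ⟨η, hη, hsub⟩ := exists_forall_values_subset_thickening hcpt
    (fun x hx => (hP x hx).2.2) hgraph x hδ
  refine Metric.isClosed_cthickening.mem_of_tendsto hlim ?_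
  have hsmall := (tendsto_one_div_add_atTop_nhds_zero_nat (𝕜 := ℝ)).comp hψ.tendsto_atTop
  filter_upwards [hlim (Metric.ball_mem_nhds x (half_pos hη)),
    hsmall.eventually_lt_const (half_pos hη)] with k hk hk'
  refine convexHull_min ?_ ((hP x hx).2.1.cthickening δ) (hu (ψ k))
  rintro y ⟨z, hz, hdist, hy⟩
  refine Metric.thickening_subset_cthickening _ _ (hsub z hz ?_ hy)
  have h1 : dist (u (ψ k)) x < η / 2 := hk
  have h2 : 1 / ((ψ k : ℝ) + 1) < η / 2 := hk'
  linarith [dist_triangle_left z x (u (ψ k))]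

end Kakutani

/-- Kakutani's fixed point theorem: a set-valued map `P` on a nonempty compact
convex subset `M ⊆ ℝⁿ` with nonempty convex values contained in `M` and closed
graph has a fixed point `x ∈ P x`. -/
theorem kakutani_fixed_point (n : ℕ) (M : Set (Fin n → ℝ))
    (hne : M.Nonempty) (hcpt : IsCompact M) (hconv : Convex ℝ M)
    (P : (Fin n → ℝ) → Set (Fin n → ℝ))
    (hP : ∀ x ∈ M, (P x).Nonempty ∧ Convex ℝ (P x) ∧ P x ⊆ M)
    (hgraph : IsClosed {p : (Fin n → ℝ) × (Fin n → ℝ) | p.1 ∈ M ∧ p.2 ∈ P p.1}) :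
    ∃ x ∈ M, x ∈ P x := by
  exact hcpt.exists_mem_of_isClosed_graph hne hconv hP hgraph
end

section
/- Let A be a finite set and X ⊆ ℝⁿ a compact positively convex subset with Δⁿ ⊆ X ⊆ {x | ∀ j, 0 ≤ x j}. Let c̃ : ℝⁿ →ₗ[ℝ] ℝ × (A → ℝⁿ) be a linear map with components c̃_o and c̃_a (a ∈ A) such that: (i) for all x with x ≥ 0 one has c̃_o x ≥ 0 and c̃_a x ≥ 0 componentwise for every a; (ii) c̃ x ∈ Ĝ X for all x ∈ X; and (iii) there is no nonempty subset I ⊆ Fin n such that c̃_o (e_j) = 0 for all j ∈ I and c̃_a (e_j) ∈ span ℝ {e_i | i ∈ I} for all a ∈ A and j ∈ I. Then there exists u ∈ ℝⁿ with u j > 0 for all j, such that: ∑ j, x j * u j ≤ t for all x ≥ 0 and t > 0 with x ∈ t • X; and c̃_o x + ∑_{a ∈ A} ∑ j, (c̃_a x) j * u j ≤ ∑ j, x j * u j for all x ≥ 0. Consequently, the pyramid Y = {x | x ≥ 0 ∧ ∑ j, x j * u j ≤ 1} satisfies X ⊆ Y and c̃ y ∈ Ĝ Y for all y ∈ Y.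 -/
open scoped Pointwise

lemma linearMap_apply_eq_dotProduct {ι : Type*} [Fintype ι] [DecidableEq ι]
    (f : (ι → ℝ) →ₗ[ℝ] ℝ) (x : ι → ℝ) : f x = x ⬝ᵥ fun j => f (Pi.single j 1) := by
  rw [LinearMap.pi_apply_eq_sum_univ f x]
  refine Finset.sum_congr rfl fun i _ => ?_
  rw [smul_eq_mul]
  congr 2
  ext j
  simp [Pi.single_apply, eq_comm]

/-- If no point of a compact convex set `S` dominates `y`, then `y` is separated from `S` by a
nonnegative vector. -/
lemma exists_nonneg_separating {ι : Type*} [Fintype ι] {S : Set (ι → ℝ)} (hS : IsCompact S)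
    (hSc : Convex ℝ S) {y : ι → ℝ} (h : ∀ x ∈ S, ¬ y ≤ x) :
    ∃ v : ι → ℝ, 0 ≤ v ∧ ∃ c : ℝ, (∀ x ∈ S, x ⬝ᵥ v < c) ∧ c < y ⬝ᵥ v := by
  classical
  obtain ⟨f, a, c, hfa, hac, hfc⟩ := geometric_hahn_banach_compact_closed hSc hS
    (convex_Ici (𝕜 := ℝ) y) isClosed_Ici (Set.disjoint_left.2 h)
  have hf (x : ι → ℝ) : f x = x ⬝ᵥ fun j => f (Pi.single j 1) :=
    linearMap_apply_eq_dotProduct f.toLinearMap x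
  refine ⟨fun j => f (Pi.single j 1), fun j => ?_, c, fun x hx => ?_, ?_⟩
  · by_contra! hneg
    simp only [Pi.zero_apply] at hneg
    have hy := hfc y Set.self_mem_Ici
    have ht : 0 < (c - f y) / f (Pi.single j 1) := div_pos_of_neg_of_neg (by linarith) hneg
    have hmem : y + ((c - f y) / f (Pi.single j 1)) • Pi.single j (1 : ℝ) ∈ Set.Ici y :=
      Set.mem_Ici.2 <| le_add_of_nonneg_right <| (smul_nonneg ht.le (Pi.single_nonneg.2 zero_le_one))
    have := hfc _ hmem
    rw [map_add, map_smul, smul_eq_mul, div_mul_cancel₀ _ hneg.ne] at this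
    linarith
  · rw [← hf]
    exact (hfa x hx).trans hac
  · rw [← hf]
    exact hfc y Set.self_mem_Ici

/-- The nonnegative part of the polar of `X`. -/
def nonnegPolar {ι : Type*} [Fintype ι] (X : Set (ι → ℝ)) : Set (ι → ℝ) :=
  {u | 0 ≤ u ∧ ∀ x ∈ X, x ⬝ᵥ u ≤ 1}

lemma convex_nonnegPolar {ι : Type*} [Fintype ι] (X : Set (ι → ℝ)) :
    Convex ℝ (nonnegPolar X) := by
  intro u hu v hv a b ha hb hab
  refine ⟨add_nonneg (smul_nonneg ha hu.1) (smul_nonneg hb hv.1), fun x hx => ?_⟩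
  rw [dotProduct_add, dotProduct_smul, dotProduct_smul, smul_eq_mul, smul_eq_mul]
  nlinarith [hu.2 x hx, hv.2 x hx]

lemma isCompact_nonnegPolar {ι : Type*} [Fintype ι] [DecidableEq ι] {X : Set (ι → ℝ)}
    (hX : ∀ j, Pi.single j (1 : ℝ) ∈ X) : IsCompact (nonnegPolar X) := by
  refine (isCompact_Icc (a := (0 : ι → ℝ)) (b := 1)).of_isClosed_subset ?_ fun u hu =>
    ⟨hu.1, fun j => by simpa using hu.2 _ (hX j)⟩
  have : nonnegPolar X = Set.Ici 0 ∩ ⋂ x ∈ X, {u | x ⬝ᵥ u ≤ 1} := by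
    ext u
    simp [nonnegPolar]
  rw [this]
  refine isClosed_Ici.inter (isClosed_biInter fun x _ => isClosed_le ?_ continuous_const)
  exact continuous_const.dotProduct continuous_id

/-- A bipolar theorem for the nonnegative polar. -/
lemma exists_le_smul_of_nonnegPolar {ι : Type*} [Fintype ι] {X : Set (ι → ℝ)}
    (hX : IsCompact X) (hX0 : (0 : ι → ℝ) ∈ X) (hXc : Convex ℝ X) {y : ι → ℝ} {s : ℝ}
    (hs : 0 < s) (h : ∀ u ∈ nonnegPolar X, y ⬝ᵥ u < s) : ∃ x ∈ X, y ≤ s • x := by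
  by_contra! hno
  obtain ⟨v, hv, c, hvc, hcv⟩ := exists_nonneg_separating hX hXc (y := s⁻¹ • y)
    fun x hx hle => hno x hx <| by
      simpa [smul_smul, hs.ne'] using smul_le_smul_of_nonneg_left hle hs.le
  have hc : 0 < c := by simpa using hvc 0 hX0
  have hu : c⁻¹ • v ∈ nonnegPolar X := by
    refine ⟨smul_nonneg (inv_nonneg.2 hc.le) hv, fun x hx => ?_⟩
    rw [dotProduct_smul, smul_eq_mul, inv_mul_le_iff₀ hc, mul_one]
    exact (hvc x hx).le
  have h1 := h _ hu
  rw [dotProduct_smul, smul_eq_mul, inv_mul_lt_iff₀ hc] at h1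
  rw [smul_dotProduct, smul_eq_mul, lt_inv_mul_iff₀ hs] at hcv
  linarith

/-- The total weight of `w ∈ ℝ × (A → ℝⁿ)` measured by the functional `u`. -/
def weight {A ι : Type*} [Fintype A] [Fintype ι] (u : ι → ℝ) :
    ℝ × (A → ι → ℝ) →ₗ[ℝ] ℝ where
  toFun w := w.1 + ∑ a, w.2 a ⬝ᵥ u
  map_add' w z := by
    simp only [Prod.fst_add, Prod.snd_add, Pi.add_apply, add_dotProduct, Finset.sum_add_distrib]
    ring
  map_smul' r w := by
    simp [Finset.mul_sum, mul_add]

lemma weight_apply {A ι : Type*} [Fintype A] [Fintype ι] (u : ι → ℝ) (w : ℝ × (A → ι → ℝ)) :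
    weight u w = w.1 + ∑ a, w.2 a ⬝ᵥ u := rfl

lemma weight_combo {A ι : Type*} [Fintype A] [Fintype ι] (u v : ι → ℝ) {r s : ℝ}
    (hrs : r + s = 1) (w : ℝ × (A → ι → ℝ)) :
    weight (r • u + s • v) w = r * weight u w + s * weight v w := by
  simp only [weight_apply, dotProduct_add, dotProduct_smul, smul_eq_mul, Finset.sum_add_distrib,
    ← Finset.mul_sum]
  linear_combination (-w.1) * hrs

lemma continuous_weight {A ι : Type*} [Fintype A] [Fintype ι] (w : ℝ × (A → ι → ℝ)) :
    Continuous fun u => weight u w := by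
  simp only [weight_apply, dotProduct]
  fun_prop

lemma weight_nonneg {A ι : Type*} [Fintype A] [Fintype ι] {u : ι → ℝ} (hu : 0 ≤ u)
    {w : ℝ × (A → ι → ℝ)} (hw : 0 ≤ w) : 0 ≤ weight u w :=
  add_nonneg hw.1 (Finset.sum_nonneg fun a _ => dotProduct_nonneg_of_nonneg (hw.2 a) hu)

lemma weight_le_one {A ι : Type*} [Fintype A] [Fintype ι] {X : Set (ι → ℝ)} {u : ι → ℝ}
    (hu : u ∈ nonnegPolar X) {w : ℝ × (A → ι → ℝ)} (hw : w ∈ Ghat A X) : weight u w ≤ 1 := by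
  obtain ⟨-, -, p, x, hpx, hsum⟩ := hw
  have : ∑ a, w.2 a ⬝ᵥ u ≤ ∑ a, p a := Finset.sum_le_sum fun a _ => by
    obtain ⟨hp, -, hx, he⟩ := hpx a
    rw [he, smul_dotProduct, smul_eq_mul]
    exact mul_le_of_le_one_right hp (hu.2 _ hx)
  rw [weight_apply]
  linarith

/-- A positive linear coalgebra on `X` has a subinvariant functional in the nonnegative polar. -/
lemma exists_subinvariant {A ι : Type*} [Fintype A] [Fintype ι] [DecidableEq ι]
    {X : Set (ι → ℝ)} (hX : IsCompact X) (hX0 : (0 : ι → ℝ) ∈ X) (hXc : Convex ℝ X)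
    (hXe : ∀ j, Pi.single j (1 : ℝ) ∈ X) (c : (ι → ℝ) →ₗ[ℝ] ℝ × (A → ι → ℝ))
    (hpos : ∀ x, 0 ≤ x → 0 ≤ c x) (hc : ∀ x ∈ X, c x ∈ Ghat A X) :
    ∃ u ∈ nonnegPolar X, ∀ x, 0 ≤ x → weight u (c x) ≤ x ⬝ᵥ u := by
  have hexp (u x : ι → ℝ) :
      weight u (c x) = x ⬝ᵥ fun j => weight u (c (Pi.single j 1)) :=
    linearMap_apply_eq_dotProduct (weight u ∘ₗ c) x
  set F : (ι → ℝ) → ι → ℝ := fun u => u - fun j => weight u (c (Pi.single j 1)) with hF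
  have hFdot (u x : ι → ℝ) : x ⬝ᵥ F u = x ⬝ᵥ u - weight u (c x) := by
    rw [hF, dotProduct_sub, ← hexp]
  have hFcont : Continuous F :=
    continuous_id.sub (continuous_pi fun j => continuous_weight _)
  have hK := isCompact_nonnegPolar hXe
  have hFconv : Convex ℝ (F '' nonnegPolar X) := by
    rintro _ ⟨u, hu, rfl⟩ _ ⟨v, hv, rfl⟩ r s hr hs hrs
    refine ⟨_, convex_nonnegPolar X hu hv hr hs hrs, ?_⟩
    ext j
    simp only [hF, Pi.sub_apply, Pi.add_apply, Pi.smul_apply, smul_eq_mul, weight_combo u v hrs]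
    ring
  by_cases hex : ∃ z ∈ F '' nonnegPolar X, 0 ≤ z
  · obtain ⟨_, ⟨u, hu, rfl⟩, hz⟩ := hex
    refine ⟨u, hu, fun x hx => ?_⟩
    have := dotProduct_nonneg_of_nonneg hx hz
    rw [hFdot] at this
    linarith
  · exfalso
    push Not at hex
    obtain ⟨v, hv, d, hd, hd0⟩ := exists_nonneg_separating (hK.image hFcont) hFconv hex
    rw [zero_dotProduct] at hd0
    have hlt : ∀ u ∈ nonnegPolar X, v ⬝ᵥ u < weight u (c v) := fun u hu => by
      have := hd _ ⟨u, hu, rfl⟩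
      rw [dotProduct_comm, hFdot] at this
      linarith
    obtain ⟨m, hm, hmax⟩ := hK.exists_isMaxOn
      ⟨0, le_rfl, fun x _ => by simp⟩ ((continuous_const (y := v)).dotProduct continuous_id).continuousOn
    obtain ⟨s, hs1, hs2⟩ := exists_between (hlt m hm)
    have hs : 0 < s := (dotProduct_nonneg_of_nonneg hv hm.1).trans_lt hs1
    obtain ⟨x, hx, hle⟩ := exists_le_smul_of_nonnegPolar hX hX0 hXc hs
      fun u hu => (hmax hu).trans_lt hs1
    have h1 := weight_nonneg hm.1 (hpos _ (sub_nonneg.2 hle))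
    rw [map_sub, map_sub, map_smul, map_smul, smul_eq_mul] at h1
    nlinarith [weight_le_one hm (hc x hx)]

lemma mem_span_single_of_support {ι : Type*} [Fintype ι] [DecidableEq ι] {I : Set ι}
    {x : ι → ℝ} (h : ∀ i ∉ I, x i = 0) :
    x ∈ Submodule.span ℝ {v : ι → ℝ | ∃ i ∈ I, v = Pi.single i (1 : ℝ)} := by
  rw [pi_eq_sum_univ' x]
  refine Submodule.sum_mem _ fun i _ => ?_
  by_cases hi : i ∈ I
  · exact Submodule.smul_mem _ _ (Submodule.subset_span ⟨i, hi, by ext j; simp [Pi.single_apply, eq_comm]⟩)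
  · simp [h i hi]

/-- Membership in `Ĝ Y` for the pyramid `Y` with positive weights `u`. -/
lemma mem_Ghat_pyramid {A ι : Type*} [Fintype A] [Fintype ι] {u : ι → ℝ} (hu : ∀ j, 0 < u j)
    {w : ℝ × (A → ι → ℝ)} (hw : 0 ≤ w) (h : weight u w ≤ 1) :
    w ∈ Ghat A {x : ι → ℝ | (∀ j, 0 ≤ x j) ∧ ∑ j, x j * u j ≤ 1} := by
  have hu0 : 0 ≤ u := fun j => (hu j).le
  have hp (a : A) : 0 ≤ w.2 a ⬝ᵥ u := dotProduct_nonneg_of_nonneg (hw.2 a) hu0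
  have hle (a : A) : w.2 a ⬝ᵥ u ≤ ∑ a, w.2 a ⬝ᵥ u :=
    Finset.single_le_sum (fun a _ => hp a) (Finset.mem_univ a)
  have hw1 : 0 ≤ w.1 := hw.1
  rw [weight_apply] at h
  refine ⟨hw1, by linarith [Finset.sum_nonneg fun a (_ : a ∈ Finset.univ) => hp a],
    fun a => w.2 a ⬝ᵥ u, fun a => (w.2 a ⬝ᵥ u)⁻¹ • w.2 a, fun a => ⟨hp a, by linarith [hle a],
      ⟨fun j => mul_nonneg (inv_nonneg.2 (hp a)) (hw.2 a j), ?_⟩, ?_⟩, h⟩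
  · change ((w.2 a ⬝ᵥ u)⁻¹ • w.2 a) ⬝ᵥ u ≤ 1
    rw [smul_dotProduct, smul_eq_mul]
    exact inv_mul_le_one
  · rcases eq_or_ne (w.2 a ⬝ᵥ u) 0 with h0 | h0
    · have hz := (Finset.sum_eq_zero_iff_of_nonneg
        fun j _ => mul_nonneg (hw.2 a j) (hu j).le).1 h0
      ext j
      simpa [h0, (hu j).ne'] using hz j (Finset.mem_univ j)
    · rw [smul_smul, mul_inv_cancel₀ h0, one_smul]

/-- The Extension Theorem (Theorem 3 of the paper): a compact positively convex
`X` with `Δⁿ ⊆ X ⊆ ℝ₊ⁿ`, carrying a `Ĝ`-coalgebra structure that is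
nonnegative on the positive orthant and does not vanish on invariant coordinate
hyperplanes, embeds into a pyramid `Y` (a free positively convex algebra with
`n` generators) which is again mapped into `Ĝ Y`. -/
theorem extension_theorem (A : Type*) [Fintype A] (n : ℕ)
    (X : Set (Fin n → ℝ))
    (hXcpt : IsCompact X) (hX0 : (0 : Fin n → ℝ) ∈ X) (hXc : Convex ℝ X)
    (hΔX : {x : Fin n → ℝ | (∀ j, 0 ≤ x j) ∧ ∑ j, x j ≤ 1} ⊆ X)
    (hXpos : X ⊆ {x : Fin n → ℝ | ∀ j, 0 ≤ x j})
    (ct : (Fin n → ℝ) →ₗ[ℝ] ℝ × (A → Fin n → ℝ))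
    (hpos : ∀ x : Fin n → ℝ, (∀ j, 0 ≤ x j) →
      0 ≤ (ct x).1 ∧ ∀ (a : A) (j : Fin n), 0 ≤ ((ct x).2 a) j)
    (hcoalg : ∀ x ∈ X, ct x ∈ Ghat A X)
    (hnv : ¬ ∃ I : Set (Fin n), I.Nonempty ∧
      (∀ j ∈ I, (ct (Pi.single j (1 : ℝ))).1 = 0) ∧
      (∀ (a : A), ∀ j ∈ I, (ct (Pi.single j (1 : ℝ))).2 a ∈
        Submodule.span ℝ
          {v : Fin n → ℝ | ∃ i ∈ I, v = Pi.single i (1 : ℝ)})) :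
    ∃ u : Fin n → ℝ, (∀ j, 0 < u j) ∧
      (∀ x : Fin n → ℝ, (∀ j, 0 ≤ x j) → ∀ t : ℝ, 0 < t → x ∈ t • X →
        ∑ j, x j * u j ≤ t) ∧
      (∀ x : Fin n → ℝ, (∀ j, 0 ≤ x j) →
        (ct x).1 + ∑ a, ∑ j, ((ct x).2 a) j * u j ≤ ∑ j, x j * u j) ∧
      X ⊆ {x : Fin n → ℝ | (∀ j, 0 ≤ x j) ∧ ∑ j, x j * u j ≤ 1} ∧
      (∀ y ∈ {x : Fin n → ℝ | (∀ j, 0 ≤ x j) ∧ ∑ j, x j * u j ≤ 1},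
        ct y ∈ Ghat A {x : Fin n → ℝ | (∀ j, 0 ≤ x j) ∧ ∑ j, x j * u j ≤ 1}) := by
  have hpos' (x : Fin n → ℝ) (hx : 0 ≤ x) : 0 ≤ ct x :=
    ⟨(hpos x hx).1, fun a j => (hpos x hx).2 a j⟩
  have hXe (j : Fin n) : Pi.single j (1 : ℝ) ∈ X :=
    hΔX ⟨(Pi.single_nonneg.2 zero_le_one : (0 : Fin n → ℝ) ≤ Pi.single j 1), by simp⟩
  obtain ⟨u, hu, hsub⟩ := exists_subinvariant hXcpt hX0 hXc hXe ct hpos' hcoalg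
  have hupos (j : Fin n) : 0 < u j := by
    refine (hu.1 j).lt_of_ne' fun hj => hnv ⟨{i | u i = 0}, ⟨j, hj⟩, ?_⟩
    have key (i : Fin n) (hi : u i = 0) :
        (ct (Pi.single i 1)).1 = 0 ∧ ∀ a, (ct (Pi.single i 1)).2 a ⬝ᵥ u = 0 := by
      have he : (0 : Fin n → ℝ) ≤ Pi.single i 1 := Pi.single_nonneg.2 zero_le_one
      have h := hsub _ he
      rw [single_dotProduct, hi, mul_zero, weight_apply] at h
      have h1 : 0 ≤ (ct (Pi.single i 1)).1 := (hpos' _ he).1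
      have h2 : ∀ a ∈ Finset.univ, 0 ≤ (ct (Pi.single i 1)).2 a ⬝ᵥ u :=
        fun a _ => dotProduct_nonneg_of_nonneg ((hpos' _ he).2 a) hu.1
      have h3 := Finset.sum_nonneg h2
      exact ⟨by linarith, fun a =>
        (Finset.sum_eq_zero_iff_of_nonneg h2).1 (by linarith) a (Finset.mem_univ a)⟩
    refine ⟨fun i hi => (key i hi).1, fun a i hi => mem_span_single_of_support fun k hk => ?_⟩
    have he : (0 : Fin n → ℝ) ≤ Pi.single i 1 := Pi.single_nonneg.2 zero_le_one
    have := (Finset.sum_eq_zero_iff_of_nonneg fun l _ =>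
      mul_nonneg ((hpos' _ he).2 a l) (hu.1 l)).1 ((key i hi).2 a) k (Finset.mem_univ k)
    exact (mul_eq_zero.1 this).resolve_right hk
  refine ⟨u, hupos, ?_, hsub, fun x hx => ⟨hXpos hx, hu.2 x hx⟩, fun y hy =>
    mem_Ghat_pyramid hupos (hpos' y hy.1) ((hsub y hy.1).trans hy.2)⟩
  rintro _ - t ht ⟨x, hx, rfl⟩
  change (t • x) ⬝ᵥ u ≤ t
  rw [smul_dotProduct, smul_eq_mul]
  exact mul_le_of_le_one_right ht.le (hu.2 x hx)
end

section
/- Let A be a finite set and n₁, n₂ ∈ ℕ. For j = 1, 2 let c̃ⱼ : ℝ^{nⱼ} →ₗ[ℝ] ℝ × (A → ℝ^{nⱼ}) be linear maps with components c̃ⱼ_o, c̃ⱼ_a such that for every x ≥ 0: c̃ⱼ_o x ≥ 0, c̃ⱼ_a x ≥ 0 componentwise for every a ∈ A, and c̃ⱼ_o x + ∑_{a ∈ A} ∑ i, (c̃ⱼ_a x) i ≤ ∑ i, x i. Let Z be a linear subspace of ℝ^{n₁} × ℝ^{n₂} such that for every (x₁, x₂) ∈ Z one has c̃₁_o x₁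 = c̃₂_o x₂ and (c̃₁_a x₁, c̃₂_a x₂) ∈ Z for every a ∈ A. Then for every (x₁, x₂) ∈ Z ∩ 2Δ^{n₁+n₂}, the pair (c̃₁_o x₁, fun a => (c̃₁_a x₁, c̃₂_a x₂)) belongs to Ĝ (Z ∩ 2Δ^{n₁+n₂}). -/
/-- A nonnegative pair of vectors in a subspace is half its total mass times an element of
the subspace that is nonnegative and has total mass at most two. -/
theorem exists_eq_half_mass_smul {ι κ : Type*} [Fintype ι] [Fintype κ]
    (Z : Submodule ℝ ((ι → ℝ) × (κ → ℝ))) {w : (ι → ℝ) × (κ → ℝ)} (hw : w ∈ Z)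
    (h₁ : ∀ i, 0 ≤ w.1 i) (h₂ : ∀ i, 0 ≤ w.2 i) :
    ∃ x ∈ Z, (∀ i, 0 ≤ x.1 i) ∧ (∀ i, 0 ≤ x.2 i) ∧ (∑ i, x.1 i) + ∑ i, x.2 i ≤ 2 ∧
      w = (((∑ i, w.1 i) + ∑ i, w.2 i) / 2) • x := by
  have s₁ : 0 ≤ ∑ i, w.1 i := Finset.sum_nonneg fun i _ => h₁ i
  have s₂ : 0 ≤ ∑ i, w.2 i := Finset.sum_nonneg fun i _ => h₂ i
  set p := ((∑ i, w.1 i) + ∑ i, w.2 i) / 2 with hp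
  have hp₀ : 0 ≤ p := by positivity
  rcases hp₀.eq_or_lt with h0 | hpos
  · refine ⟨0, Z.zero_mem, by simp, by simp, by simp, ?_⟩
    have e₁ : ∑ i, w.1 i = 0 := by linarith
    have e₂ : ∑ i, w.2 i = 0 := by linarith
    rw [Finset.sum_eq_zero_iff_of_nonneg fun i _ => h₁ i] at e₁
    rw [Finset.sum_eq_zero_iff_of_nonneg fun i _ => h₂ i] at e₂
    rw [smul_zero]
    exact Prod.ext (funext fun i => e₁ i (Finset.mem_univ i))
      (funext fun i => e₂ i (Finset.mem_univ i))
  · refine ⟨p⁻¹ • w, Z.smul_mem _ hw, fun i => mul_nonneg (inv_nonneg.2 hp₀) (h₁ i),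
      fun i => mul_nonneg (inv_nonneg.2 hp₀) (h₂ i), ?_, (smul_inv_smul₀ hpos.ne' w).symm⟩
    simp only [Prod.smul_fst, Prod.smul_snd, Pi.smul_apply, smul_eq_mul, ← Finset.mul_sum]
    rw [← mul_add, show (∑ i, w.1 i) + ∑ i, w.2 i = p * 2 by rw [hp]; ring,
      inv_mul_cancel_left₀ hpos.ne']

/-- Lemma 5 of the paper: the common coalgebra structure `d` on the subspace `Z`
maps `Z ∩ 2Δ^{n₁+n₂}` into `Ĝ (Z ∩ 2Δ^{n₁+n₂})`. -/
theorem d_maps_into_Ghat (A : Type*) [Fintype A] (n₁ n₂ : ℕ)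
    (ct₁ : (Fin n₁ → ℝ) →ₗ[ℝ] ℝ × (A → Fin n₁ → ℝ))
    (ct₂ : (Fin n₂ → ℝ) →ₗ[ℝ] ℝ × (A → Fin n₂ → ℝ))
    (h₁ : ∀ x : Fin n₁ → ℝ, (∀ i, 0 ≤ x i) →
      0 ≤ (ct₁ x).1 ∧ (∀ (a : A) (i : Fin n₁), 0 ≤ ((ct₁ x).2 a) i) ∧
      (ct₁ x).1 + ∑ a, ∑ i, ((ct₁ x).2 a) i ≤ ∑ i, x i)
    (h₂ : ∀ x : Fin n₂ → ℝ, (∀ i, 0 ≤ x i) →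
      0 ≤ (ct₂ x).1 ∧ (∀ (a : A) (i : Fin n₂), 0 ≤ ((ct₂ x).2 a) i) ∧
      (ct₂ x).1 + ∑ a, ∑ i, ((ct₂ x).2 a) i ≤ ∑ i, x i)
    (Z : Submodule ℝ ((Fin n₁ → ℝ) × (Fin n₂ → ℝ)))
    (hZ : ∀ z ∈ Z, (ct₁ z.1).1 = (ct₂ z.2).1 ∧
      ∀ a : A, ((ct₁ z.1).2 a, (ct₂ z.2).2 a) ∈ Z) :
    ∀ z ∈ (Z : Set ((Fin n₁ → ℝ) × (Fin n₂ → ℝ))) ∩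
        {w : (Fin n₁ → ℝ) × (Fin n₂ → ℝ) |
          (∀ i, 0 ≤ w.1 i) ∧ (∀ i, 0 ≤ w.2 i) ∧
          (∑ i, w.1 i) + ∑ i, w.2 i ≤ 2},
      ((ct₁ z.1).1, fun a => ((ct₁ z.1).2 a, (ct₂ z.2).2 a)) ∈
        Ghat A ((Z : Set ((Fin n₁ → ℝ) × (Fin n₂ → ℝ))) ∩
          {w : (Fin n₁ → ℝ) × (Fin n₂ → ℝ) |
            (∀ i, 0 ≤ w.1 i) ∧ (∀ i, 0 ≤ w.2 i) ∧
            (∑ i, w.1 i) + ∑ i, w.2 i ≤ 2}) := by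
  rintro z ⟨hz, hz₁, hz₂, hsum⟩
  obtain ⟨o₁, n₁', m₁⟩ := h₁ z.1 hz₁
  obtain ⟨o₂, n₂', m₂⟩ := h₂ z.2 hz₂
  obtain ⟨ho, hmem⟩ := hZ z hz
  choose x hxZ hx₁ hx₂ hx hxe using fun a =>
    exists_eq_half_mass_smul Z (hmem a) (n₁' a) (n₂' a)
  set p : A → ℝ := fun a => ((∑ i, (ct₁ z.1).2 a i) + ∑ i, (ct₂ z.2).2 a i) / 2 with hp
  have hp₀ : ∀ a, 0 ≤ p a := fun a =>
    div_nonneg (add_nonneg (Finset.sum_nonneg fun i _ => n₁' a i)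
      (Finset.sum_nonneg fun i _ => n₂' a i)) zero_le_two
  have hmass : (ct₁ z.1).1 + ∑ a, p a ≤ 1 := by
    rw [hp, ← Finset.sum_div, Finset.sum_add_distrib]
    linarith
  have hle : ∀ a, p a ≤ ∑ a, p a := fun a =>
    Finset.single_le_sum (fun b _ => hp₀ b) (Finset.mem_univ a)
  have hpsum : 0 ≤ ∑ a, p a := Finset.sum_nonneg fun a _ => hp₀ a
  exact ⟨o₁, by linarith, p, x, fun a =>
    ⟨hp₀ a, by linarith [hle a], ⟨hxZ a, hx₁ a, hx₂ a, hx a⟩, hxe a⟩, hmass⟩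
end

section
/- Let A be a finite set, c̃ : ℝⁿ →ₗ[ℝ] ℝ × (A → ℝⁿ) a linear map, and let B, C ⊆ ℝⁿ be positively convex subsets with c̃ b ∈ Ĝ B for all b ∈ B and c̃ c ∈ Ĝ C for all c ∈ C. Then c̃ y ∈ Ĝ (convexHull ℝ (B ∪ C)) for every y ∈ convexHull ℝ (B ∪ C). -/
open scoped Pointwise in
theorem convex_Ghat {A : Type*} [Fintype A] {V : Type*} [AddCommGroup V] [Module ℝ V]
    {X : Set V} (hX : Convex ℝ X) : Convex ℝ (Ghat A X) := by
  rintro ⟨o₁, φ₁⟩ ⟨ho₁, -, p, x, hp, hp_sum⟩ ⟨o₂, φ₂⟩ ⟨ho₂, -, q, y, hq, hq_sum⟩ s t hs ht hst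
  dsimp only at *
  have hmem : ∀ a, ∃ z ∈ X, s • φ₁ a + t • φ₂ a = (s * p a + t * q a) • z := by
    intro a
    obtain ⟨hpa, -, hxa, hφ₁⟩ := hp a
    obtain ⟨hqa, -, hya, hφ₂⟩ := hq a
    have h : (s * p a) • x a + (t * q a) • y a ∈ (s * p a + t * q a) • X := by
      rw [hX.add_smul (by positivity) (by positivity)]
      exact Set.add_mem_add (Set.smul_mem_smul_set hxa) (Set.smul_mem_smul_set hya)
    obtain ⟨z, hz, hzeq⟩ := Set.mem_smul_set.mp h
    exact ⟨z, hz, by rw [hzeq, hφ₁, hφ₂, smul_smul, smul_smul]⟩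
  choose z hz hzeq using hmem
  have hr : ∀ a, 0 ≤ s * p a + t * q a := fun a ↦
    add_nonneg (mul_nonneg hs (hp a).1) (mul_nonneg ht (hq a).1)
  have ho : 0 ≤ s * o₁ + t * o₂ := by positivity
  have hsum : s * o₁ + t * o₂ + ∑ a, (s * p a + t * q a) ≤ 1 := by
    rw [Finset.sum_add_distrib, ← Finset.mul_sum, ← Finset.mul_sum]
    linarith [mul_le_mul_of_nonneg_left hp_sum hs, mul_le_mul_of_nonneg_left hq_sum ht]
  refine ⟨ho, ?_, fun a ↦ s * p a + t * q a, z, fun a ↦ ⟨hr a, ?_, hz a, hzeq a⟩, hsum⟩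
  · change s * o₁ + t * o₂ ≤ 1
    linarith [Finset.sum_nonneg fun a (_ : a ∈ Finset.univ) ↦ hr a]
  · linarith [Finset.single_le_sum (fun a _ ↦ hr a) (Finset.mem_univ a)]

theorem Ghat_mono {A : Type*} [Fintype A] {V : Type*} [AddCommGroup V] [Module ℝ V]
    {X Y : Set V} (h : X ⊆ Y) : Ghat A X ⊆ Ghat A Y := by
  rintro _ ⟨h₀, h₁, p, x, hp, hsum⟩
  exact ⟨h₀, h₁, p, x, fun a ↦ ⟨(hp a).1, (hp a).2.1, h (hp a).2.2.1, (hp a).2.2.2⟩, hsum⟩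

/-- Lemma 6 of the paper: if a linear map `c̃` maps positively convex sets `B`
and `C` into `Ĝ B` and `Ĝ C` respectively, then it maps the convex hull of
`B ∪ C` into `Ĝ (convexHull ℝ (B ∪ C))`. -/
theorem Ghat_convexHull_union (A : Type*) [Fintype A] (n : ℕ)
    (ct : (Fin n → ℝ) →ₗ[ℝ] ℝ × (A → Fin n → ℝ))
    (B C : Set (Fin n → ℝ))
    (hB0 : (0 : Fin n → ℝ) ∈ B) (hBc : Convex ℝ B)
    (hC0 : (0 : Fin n → ℝ) ∈ C) (hCc : Convex ℝ C)
    (hB : ∀ b ∈ B, ct b ∈ Ghat A B) (hC : ∀ c ∈ C, ct c ∈ Ghat A C) :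
    ∀ y ∈ convexHull ℝ (B ∪ C), ct y ∈ Ghat A (convexHull ℝ (B ∪ C)) := by
  have hunion : B ∪ C ⊆ convexHull ℝ (B ∪ C) := subset_convexHull ℝ _
  refine convexHull_min (t := ct ⁻¹' Ghat A (convexHull ℝ (B ∪ C))) (Set.union_subset ?_ ?_)
    ((convex_Ghat (convex_convexHull ℝ _)).linear_preimage ct)
  · exact fun b hb ↦ Ghat_mono (Set.subset_union_left.trans hunion) (hB b hb)
  · exact fun c hc ↦ Ghat_mono (Set.subset_union_right.trans hunion) (hC c hc)
end

section
/- Let A be a finite set and c̃ : ℝⁿ →ₗ[ℝ] ℝ × (A → ℝⁿ) a linear map with components c̃_o, c̃_a such that c̃ x ∈ Ĝ Δⁿ for every x ∈ Δⁿ. Let I ⊆ Fin n be nonempty with c̃_o (e_k) = 0 for all k ∈ I and c̃_a (e_k) ∈ convexHull ℝ ({e_i | i ∈ I} ∪ {0}) for all a ∈ A and k ∈ I. Let f : ℝⁿ →ₗ[ℝ] ℝⁿ be the linear map with f (e_k) = 0 for k ∈ I and f (e_k) = e_k for k ∉ I, and let X = Δⁿ ∩ {x | ∀ k ∈ I, x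 k = 0}. Then: (i) for every x ∈ Δⁿ, c̃_o x = c̃_o (f x) and f (c̃_a x) = f (c̃_a (f x)) for every a ∈ A; and (ii) for every y ∈ X, the pair (c̃_o y, fun a => f (c̃_a y)) belongs to Ĝ X. In other words, f is a morphism of Ĝ-coalgebras from (Δⁿ, c̃|Δⁿ) onto the induced coalgebra on the face X. -/
/-- A linear endomorphism fixing the basis vectors outside `I` and killing those in `I` is the
coordinate projection that zeroes the coordinates in `I`. -/
theorem apply_eq_zero_or_self_of_collapse {n : ℕ} {I : Set (Fin n)}
    {f : (Fin n → ℝ) →ₗ[ℝ] (Fin n → ℝ)}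
    (hfI : ∀ k ∈ I, f (Pi.single k (1 : ℝ)) = 0)
    (hfI' : ∀ k ∉ I, f (Pi.single k (1 : ℝ)) = Pi.single k (1 : ℝ)) (x : Fin n → ℝ)
    (j : Fin n) : (j ∈ I → f x j = 0) ∧ (j ∉ I → f x j = x j) := by
  have hx : f x j = ∑ k, x k * f (Pi.single k (1 : ℝ)) j := by
    conv_lhs => rw [pi_eq_sum_univ' x, map_sum, Finset.sum_apply]
    refine Finset.sum_congr rfl fun k _ => ?_
    rw [map_smul, Pi.smul_apply, smul_eq_mul]
  rw [hx]
  constructor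
  · intro hj
    refine Finset.sum_eq_zero fun k _ => ?_
    by_cases hk : k ∈ I
    · simp [hfI k hk]
    · have hjk : j ≠ k := fun h => hk (h ▸ hj)
      simp [hfI' k hk, hjk]
  · intro hj
    rw [Finset.sum_eq_single j]
    · simp [hfI' j hj]
    · intro k _ hkj
      by_cases hk : k ∈ I
      · simp [hfI k hk]
      · simp [hfI' k hk, hkj.symm]
    · simp

/-- A linear map vanishing on the basis vectors collapsed by `f` factors through `f`. -/
theorem apply_eq_apply_collapse {n : ℕ} {I : Set (Fin n)} {W : Type*} [AddCommGroup W]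
    [Module ℝ W] {f : (Fin n → ℝ) →ₗ[ℝ] (Fin n → ℝ)}
    (hfI : ∀ k ∈ I, f (Pi.single k (1 : ℝ)) = 0)
    (hfI' : ∀ k ∉ I, f (Pi.single k (1 : ℝ)) = Pi.single k (1 : ℝ))
    (g : (Fin n → ℝ) →ₗ[ℝ] W) (hg : ∀ k ∈ I, g (Pi.single k (1 : ℝ)) = 0)
    (x : Fin n → ℝ) : g x = g (f x) := by
  have h : g = g ∘ₗ f := by
    refine LinearMap.pi_ext' fun k => LinearMap.ext_ring ?_
    simp only [LinearMap.comp_apply, LinearMap.single_apply]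
    by_cases hk : k ∈ I
    · rw [hfI k hk, hg k hk, map_zero]
    · rw [hfI' k hk]
  exact LinearMap.congr_fun h x

/-- Lemma 8 of the paper: collapsing an invariant face of the simplex yields a
`Ĝ`-coalgebra morphism onto the induced coalgebra on that face. -/
theorem collapse_invariant_face (A : Type*) [Fintype A] (n : ℕ)
    (ct : (Fin n → ℝ) →ₗ[ℝ] ℝ × (A → Fin n → ℝ))
    (hcoalg : ∀ x ∈ {x : Fin n → ℝ | (∀ i, 0 ≤ x i) ∧ ∑ i, x i ≤ 1},
      ct x ∈ Ghat A {x : Fin n → ℝ | (∀ i, 0 ≤ x i) ∧ ∑ i, x i ≤ 1})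
    (I : Set (Fin n)) (hI : I.Nonempty)
    (hIo : ∀ k ∈ I, (ct (Pi.single k (1 : ℝ))).1 = 0)
    (hIa : ∀ (a : A), ∀ k ∈ I, (ct (Pi.single k (1 : ℝ))).2 a ∈
      convexHull ℝ
        ({v : Fin n → ℝ | ∃ i ∈ I, v = Pi.single i (1 : ℝ)} ∪ {0}))
    (f : (Fin n → ℝ) →ₗ[ℝ] (Fin n → ℝ))
    (hfI : ∀ k ∈ I, f (Pi.single k (1 : ℝ)) = 0)
    (hfI' : ∀ k ∉ I, f (Pi.single k (1 : ℝ)) = Pi.single k (1 : ℝ)) :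
    (∀ x ∈ {x : Fin n → ℝ | (∀ i, 0 ≤ x i) ∧ ∑ i, x i ≤ 1},
      (ct x).1 = (ct (f x)).1 ∧ ∀ a : A, f ((ct x).2 a) = f ((ct (f x)).2 a)) ∧
    (∀ y ∈ ({x : Fin n → ℝ | (∀ i, 0 ≤ x i) ∧ ∑ i, x i ≤ 1} ∩
        {x : Fin n → ℝ | ∀ k ∈ I, x k = 0}),
      ((ct y).1, fun a => f ((ct y).2 a)) ∈
        Ghat A ({x : Fin n → ℝ | (∀ i, 0 ≤ x i) ∧ ∑ i, x i ≤ 1} ∩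
          {x : Fin n → ℝ | ∀ k ∈ I, x k = 0})) := by
  constructor
  · intro x _
    refine ⟨apply_eq_apply_collapse hfI hfI' (LinearMap.fst ℝ _ _ ∘ₗ ct) hIo x, fun a => ?_⟩
    refine apply_eq_apply_collapse hfI hfI'
      (f ∘ₗ LinearMap.proj a ∘ₗ LinearMap.snd ℝ _ _ ∘ₗ ct) (fun k hk => ?_) x
    have hker : convexHull ℝ ({v : Fin n → ℝ | ∃ i ∈ I, v = Pi.single i (1 : ℝ)} ∪ {0}) ⊆
        (LinearMap.ker f : Set (Fin n → ℝ)) := by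
      refine convexHull_min ?_ (LinearMap.ker f).convex
      rintro v (⟨i, hi, rfl⟩ | rfl)
      · exact hfI i hi
      · exact map_zero f
    exact hker (hIa a k hk)
  · rintro y ⟨hy, -⟩
    obtain ⟨h0, h1, p, x, hp, hsum⟩ := hcoalg y hy
    refine ⟨h0, h1, p, fun a => f (x a), fun a => ?_, hsum⟩
    obtain ⟨hp0, hp1, ⟨hx0, hx1⟩, hpx⟩ := hp a
    have hf := apply_eq_zero_or_self_of_collapse hfI hfI' (x a)
    have hle : ∀ i, 0 ≤ f (x a) i ∧ f (x a) i ≤ x a i := fun i => by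
      by_cases hi : i ∈ I
      · rw [(hf i).1 hi]
        exact ⟨le_rfl, hx0 i⟩
      · rw [(hf i).2 hi]
        exact ⟨hx0 i, le_rfl⟩
    refine ⟨hp0, hp1, ⟨⟨fun i => (hle i).1, ?_⟩, fun k hk => (hf k).1 hk⟩, ?_⟩
    · exact (Finset.sum_le_sum fun i _ => (hle i).2).trans hx1
    · simp only [hpx, map_smul]
end
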